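/- arXiv:2212.03173 — 8 statements merged into one kernel-verified Lean document; each statement's English description precedes it below -/
import Mathlib

section
/- Let F ⊆ GL_n(ℂ) be closed in GL_n(ℂ) (with the subspace topology inherited from the space of n×n complex matrices). Then the set sLog(F) = { x ∈ ℝⁿ : there exists A ∈ F whose singular values, listed with multiplicity in some order, are exp(x_1),…,exp(x_n) } is a closed subset of ℝⁿ. In particular, the matrix amoeba of any subvariety of GL_n(ℂ) is closed. -/
open Matrix

/-- The singular values of a complex `n × n` matrix `A`: the nonnegative square roots of the
eigenvalues of the Hermitian matrix `A * Aᴴ`. -/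
noncomputable def singularValues {n : ℕ} (A : Matrix (Fin n) (Fin n) ℂ) : Fin n → ℝ :=
  fun i => Real.sqrt ((Matrix.isHermitian_mul_conjTranspose_self A).eigenvalues i)

/-- Two families with the same multiset of values differ by a bijection of their index types. -/
theorem exists_equiv_comp_eq_of_map_univ_eq {ι κ α : Type*} [Fintype ι] [Fintype κ]
    {f : ι → α} {g : κ → α} (h : Finset.univ.val.map f = Finset.univ.val.map g) :
    ∃ e : ι ≃ κ, ∀ i, g (e i) = f i := by
  classical
  have hcard (c : α) : Fintype.card {i // f i = c} = Fintype.card {j // g j = c} := by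
    have := congrArg (Multiset.count c) h
    simp only [Multiset.count_map, eq_comm (a := c)] at this
    rw [Fintype.card_subtype, Fintype.card_subtype]
    exact this
  exact ⟨Equiv.ofFiberEquiv fun c => Fintype.equivOfCardEq (hcard c),
    Equiv.ofFiberEquiv_map _⟩

open Polynomial ComplexOrder in
/-- The singular values of `A` are `exp (x 1), …, exp (x n)` in some order iff the characteristic
polynomial of `A * Aᴴ` has the roots `exp (x 1) ^ 2, …, exp (x n) ^ 2`. -/
theorem exists_perm_singularValues_eq_exp_iff {n : ℕ} (A : Matrix (Fin n) (Fin n) ℂ)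
    (x : Fin n → ℝ) :
    (∃ σ : Equiv.Perm (Fin n), ∀ i, singularValues A (σ i) = Real.exp (x i)) ↔
      ∀ t : ℂ, (scalar (Fin n) t - A * Aᴴ).det = ∏ i, (t - ((Real.exp (x i) ^ 2 : ℝ) : ℂ)) := by
  have hA := isHermitian_mul_conjTranspose_self A
  have hchar (t : ℂ) : (scalar (Fin n) t - A * Aᴴ).det = ∏ i, (t - (hA.eigenvalues i : ℂ)) := by
    rw [← eval_charpoly, hA.charpoly_eq]
    simp [eval_prod]
  constructor
  · rintro ⟨σ, hσ⟩ t
    rw [hchar, ← Equiv.prod_comp σ]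
    refine Finset.prod_congr rfl fun i _ => ?_
    rw [← hσ i, singularValues,
      Real.sq_sqrt ((posSemidef_self_mul_conjTranspose A).eigenvalues_nonneg _)]
  · intro h
    have hpoly : (∏ i, (X - C (hA.eigenvalues i : ℂ))) =
        ∏ i, (X - C ((Real.exp (x i) ^ 2 : ℝ) : ℂ)) := by
      refine Polynomial.funext fun t => ?_
      simpa [eval_prod] using (hchar t).symm.trans (h t)
    have hroots := congrArg Polynomial.roots hpoly
    have hprod_ne (y : Fin n → ℂ) : ∏ i, (X - C (y i)) ≠ 0 :=
      Finset.prod_ne_zero_iff.2 fun i _ => X_sub_C_ne_zero (y i)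
    rw [roots_prod _ _ (hprod_ne _), roots_prod _ _ (hprod_ne _)] at hroots
    simp only [roots_X_sub_C, Multiset.bind_singleton] at hroots
    obtain ⟨σ, hσ⟩ := exists_equiv_comp_eq_of_map_univ_eq hroots.symm
    refine ⟨σ, fun i => ?_⟩
    rw [singularValues, Complex.ofReal_injective (hσ i), Real.sqrt_sq (Real.exp_pos _).le]

open ComplexOrder in
/-- The squared Frobenius norm is the sum of the squares of the singular values. -/
theorem sum_normSq_entries_eq_sum_sq_singularValues {n : ℕ} (A : Matrix (Fin n) (Fin n) ℂ) :
    ∑ i, ∑ j, ‖A i j‖ ^ 2 = ∑ i, singularValues A i ^ 2 := by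
  have h := (isHermitian_mul_conjTranspose_self A).trace_eq_sum_eigenvalues
  have htrace : (A * Aᴴ).trace = ((∑ i, ∑ j, ‖A i j‖ ^ 2 : ℝ) : ℂ) := by
    simp [trace, mul_apply, Complex.mul_conj']
  rw [htrace] at h
  have hsum : (∑ i, ∑ j, ‖A i j‖ ^ 2) = ∑ i, (isHermitian_mul_conjTranspose_self A).eigenvalues i := by
    exact Complex.ofReal_injective (h.trans (Complex.ofReal_sum _ _).symm)
  rw [hsum]
  refine Finset.sum_congr rfl fun i _ => ?_
  rw [singularValues, Real.sq_sqrt ((posSemidef_self_mul_conjTranspose A).eigenvalues_nonneg _)]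

/-- If `F` is a closed subset of `GL_n(ℂ)` (with the subspace topology inherited from the
space of `n × n` complex matrices), then `sLog(F) ⊆ ℝⁿ`, the set of vectors `x` such that some
`A ∈ F` has singular values `exp (x 1), …, exp (x n)` listed with multiplicity in some order,
is closed in `ℝⁿ`. -/
theorem stmt2 {n : ℕ} (F : Set {A : Matrix (Fin n) (Fin n) ℂ // IsUnit A.det})
    (hF : IsClosed F) :
    IsClosed {x : Fin n → ℝ | ∃ A ∈ F, ∃ σ : Equiv.Perm (Fin n),
      ∀ i, singularValues (A : Matrix (Fin n) (Fin n) ℂ) (σ i) = Real.exp (x i)} := by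
  rw [← isSeqClosed_iff_isClosed]
  intro x x₀ hx hlim
  choose A hAF hA using hx
  have hbound : ∃ R, ∀ k i j, ‖(A k).1 i j‖ ≤ R := by
    have hconv : Filter.Tendsto (fun k => ∑ i, Real.exp (x k i) ^ 2) Filter.atTop
        (nhds (∑ i, Real.exp (x₀ i) ^ 2)) :=
      ((by fun_prop : Continuous fun y : Fin n → ℝ => ∑ i, Real.exp (y i) ^ 2).tendsto x₀).comp hlim
    obtain ⟨R, hR⟩ := hconv.bddAbove_range
    refine ⟨√R, fun k i j => Real.le_sqrt_of_sq_le ?_⟩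
    obtain ⟨σ, hσ⟩ := hA k
    calc ‖(A k).1 i j‖ ^ 2 ≤ ∑ j, ‖(A k).1 i j‖ ^ 2 :=
          Finset.single_le_sum (f := fun j => ‖(A k).1 i j‖ ^ 2)
            (fun _ _ => by positivity) (Finset.mem_univ j)
      _ ≤ ∑ i, ∑ j, ‖(A k).1 i j‖ ^ 2 :=
          Finset.single_le_sum (f := fun i => ∑ j, ‖(A k).1 i j‖ ^ 2)
            (fun _ _ => by positivity) (Finset.mem_univ i)
      _ = ∑ i, Real.exp (x k i) ^ 2 := by
          rw [sum_normSq_entries_eq_sum_sq_singularValues, ← Equiv.sum_comp σ]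
          simp_rw [hσ]
      _ ≤ R := hR ⟨k, rfl⟩
  obtain ⟨R, hR⟩ := hbound
  have hcompact : IsCompact {B : Matrix (Fin n) (Fin n) ℂ | ∀ i, B i ∈
      {v : Fin n → ℂ | ∀ j, v j ∈ Metric.closedBall (0 : ℂ) R}} :=
    isCompact_pi_infinite fun _ => isCompact_pi_infinite fun _ => isCompact_closedBall 0 R
  have : FirstCountableTopology (Matrix (Fin n) (Fin n) ℂ) :=
    inferInstanceAs (FirstCountableTopology (Fin n → Fin n → ℂ))
  obtain ⟨B, -, φ, hφ, hB⟩ := hcompact.tendsto_subseq (x := fun k => (A k).1)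
    fun k i j => by simpa using hR k i j
  have hdet (t : ℂ) : (scalar (Fin n) t - B * Bᴴ).det =
      ∏ i, (t - ((Real.exp (x₀ i) ^ 2 : ℝ) : ℂ)) := by
    refine tendsto_nhds_unique
      (((by fun_prop : Continuous fun M : Matrix (Fin n) (Fin n) ℂ =>
        (scalar (Fin n) t - M * Mᴴ).det).tendsto B).comp hB) ?_
    have hprod := ((by fun_prop : Continuous fun y : Fin n → ℝ =>
        ∏ i, (t - ((Real.exp (y i) ^ 2 : ℝ) : ℂ))).tendsto x₀).comp (hlim.comp hφ.tendsto_atTop)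
    refine hprod.congr fun k => ?_
    exact ((exists_perm_singularValues_eq_exp_iff _ _).1 (hA (φ k)) t).symm
  have hBunit : IsUnit B.det := by
    rw [isUnit_iff_ne_zero]
    intro h0
    have hzero := hdet 0
    rw [map_zero, zero_sub, det_neg, det_mul, h0, zero_mul, mul_zero, eq_comm,
      Finset.prod_eq_zero_iff] at hzero
    obtain ⟨i, -, hi⟩ := hzero
    rw [zero_sub, neg_eq_zero, Complex.ofReal_eq_zero] at hi
    exact (pow_pos (Real.exp_pos (x₀ i)) 2).ne' hi
  refine ⟨⟨B, hBunit⟩, ?_, (exists_perm_singularValues_eq_exp_iff B x₀).2 hdet⟩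
  exact hF.isSeqClosed (fun k => hAF (φ k)) (tendsto_subtype_rng.2 hB)
end

section
/- Let f : Mat_n(ℂ) → ℂ be a polynomial function (the evaluation of a multivariate polynomial in the n² matrix entries). Then every connected component of the complement ℝⁿ ∖ sA(f) of the matrix amoeba of f is a convex subset of ℝⁿ. -/
open Matrix

/-- The matrix amoeba of a function `f` on `n × n` complex matrices: the set of `x ∈ ℝⁿ`
for which some invertible `A` with `f A = 0` has singular values
`exp (x 1), …, exp (x n)` listed with multiplicity in some order. -/
def sAmoeba {n : ℕ} (f : Matrix (Fin n) (Fin n) ℂ → ℂ) : Set (Fin n → ℝ) :=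
  {x | ∃ A : Matrix (Fin n) (Fin n) ℂ, IsUnit A.det ∧ f A = 0 ∧
    ∃ σ : Equiv.Perm (Fin n), ∀ i, singularValues A (σ i) = Real.exp (x i)}

/-- Two families with the same multiset of values differ by a permutation of the indices. -/
theorem exists_perm_of_map_univ_eq {ι α : Type*} [Fintype ι] {f g : ι → α}
    (h : Multiset.map f Finset.univ.val = Multiset.map g Finset.univ.val) :
    ∃ σ : Equiv.Perm ι, ∀ i, f (σ i) = g i := by
  classical
  have key : ∀ b, Nonempty ({i // g i = b} ≃ {i // f i = b}) := fun b => by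
    refine Fintype.card_eq.1 ?_
    have hb := congrArg (Multiset.count b) h
    rw [Multiset.count_map, Multiset.count_map] at hb
    simp only [Fintype.card_subtype]
    simpa [Finset.card_def, eq_comm] using hb.symm
  exact ⟨Equiv.ofFiberEquiv fun b => (key b).some, fun i => Equiv.ofFiberEquiv_map _ i⟩

namespace Matrix

theorem mul_diagonal_mul_submatrix_perm {m R : Type*} [Fintype m] [DecidableEq m] [CommRing R]
    (U V : Matrix m m R) (d : m → R) (σ : Equiv.Perm m) :
    U.submatrix id σ * diagonal (d ∘ σ) * V.submatrix σ id = U * diagonal d * V := by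
  ext i j
  simp only [mul_apply (M := _ * _), mul_diagonal, submatrix_apply, id, Function.comp]
  exact Equiv.sum_comp σ fun k => U i k * d k * V k j

/-- Singular value decomposition of an invertible matrix. -/
theorem exists_unitary_mul_diagonal_singularValues_mul {n : ℕ} {A : Matrix (Fin n) (Fin n) ℂ}
    (hA : IsUnit A.det) :
    ∃ U ∈ unitaryGroup (Fin n) ℂ, ∃ V ∈ unitaryGroup (Fin n) ℂ,
      A = U * diagonal (fun i => (singularValues A i : ℂ)) * V := by
  have hH := isHermitian_mul_conjTranspose_self A
  have hev : ∀ i, 0 < hH.eigenvalues i := by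
    open scoped ComplexOrder in
    exact (PosDef.mul_conjTranspose_self A
      (vecMul_injective_of_isUnit ((isUnit_iff_isUnit_det A).2 hA))).eigenvalues_pos
  set W : Matrix (Fin n) (Fin n) ℂ := hH.eigenvectorUnitary.1
  have hWmem : W ∈ unitaryGroup (Fin n) ℂ := hH.eigenvectorUnitary.2
  have hW : Wᴴ * W = 1 := Unitary.star_mul_self_of_mem hWmem
  have hW' : W * Wᴴ = 1 := Unitary.mul_star_self_of_mem hWmem
  set s : Fin n → ℂ := fun i => (singularValues A i : ℂ)
  have hs : ∀ i, s i ≠ 0 := fun i =>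
    Complex.ofReal_ne_zero.2 (Real.sqrt_pos.2 (hev i)).ne'
  have hss : RCLike.ofReal ∘ hH.eigenvalues = fun i => s i * s i := by
    funext i
    rw [← Complex.ofReal_mul]
    exact congrArg _ (Real.mul_self_sqrt (hev i).le).symm
  have hspec : A * Aᴴ = W * diagonal (fun i => s i * s i) * Wᴴ := by
    rw [← hss]
    exact hH.spectral_theorem.trans (Unitary.conjStarAlgAut_apply _ _)
  set T : Matrix (Fin n) (Fin n) ℂ := diagonal fun i => (s i)⁻¹
  have hT : Tᴴ = T := by
    rw [diagonal_conjTranspose]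
    congr 1
    funext i
    simp [s]
  have hsT : diagonal s * T = 1 := by
    rw [diagonal_mul_diagonal, ← diagonal_one]
    congr 1
    funext i
    exact mul_inv_cancel₀ (hs i)
  have hTs : T * diagonal s = 1 := mul_eq_one_comm.1 hsT
  refine ⟨W, hWmem, T * Wᴴ * A, ?_, ?_⟩
  · rw [mem_unitaryGroup_iff, star_eq_conjTranspose]
    calc T * Wᴴ * A * (T * Wᴴ * A)ᴴ = T * (Wᴴ * (A * Aᴴ) * W) * T := by
          simp only [conjTranspose_mul, conjTranspose_conjTranspose, hT, Matrix.mul_assoc]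
      _ = T * ((Wᴴ * W) * (diagonal s * diagonal s) * (Wᴴ * W)) * T := by
          rw [hspec, diagonal_mul_diagonal]
          simp only [Matrix.mul_assoc]
      _ = (T * diagonal s) * (diagonal s * T) := by
          rw [hW, Matrix.one_mul, Matrix.mul_one]
          simp only [Matrix.mul_assoc]
      _ = 1 := by rw [hsT, hTs, Matrix.one_mul]
  · calc A = W * (diagonal s * T) * Wᴴ * A := by
          rw [hsT, Matrix.mul_one, hW', Matrix.one_mul]
      _ = W * diagonal s * (T * Wᴴ * A) := by simp only [Matrix.mul_assoc]

/-- The singular values of `U * diagonal d * V`, with `U`, `V` unitary and `d` nonnegative, are the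
entries of `d` up to order. -/
theorem exists_perm_singularValues_unitary_mul_diagonal_mul {n : ℕ}
    {U V : Matrix (Fin n) (Fin n) ℂ} (hU : U ∈ unitaryGroup (Fin n) ℂ)
    (hV : V ∈ unitaryGroup (Fin n) ℂ) {d : Fin n → ℝ} (hd : ∀ i, 0 ≤ d i) :
    ∃ σ : Equiv.Perm (Fin n), ∀ i,
      singularValues (U * diagonal (fun i => (d i : ℂ)) * V) (σ i) = d i := by
  set D : Matrix (Fin n) (Fin n) ℂ := diagonal (fun i => (d i : ℂ))
  have hDH : Dᴴ = D := by
    simp only [D, diagonal_conjTranspose]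
    congr 1
    funext i
    simp
  have hU' : star U * U = 1 := Unitary.star_mul_self_of_mem hU
  have hV' : V * star V = 1 := Unitary.mul_star_self_of_mem hV
  have hAA : (U * D * V) * (U * D * V)ᴴ = U * (D * D) * star U := by
    calc _ = U * D * (V * star V) * Dᴴ * star U := by
          simp only [conjTranspose_mul, star_eq_conjTranspose, Matrix.mul_assoc]
      _ = _ := by rw [hV', Matrix.mul_one, hDH]; simp only [Matrix.mul_assoc]
  have hH := isHermitian_mul_conjTranspose_self (U * D * V)
  have hroots := hH.roots_charpoly_eq_eigenvalues
  have hchar : ((U * D * V) * (U * D * V)ᴴ).charpoly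
      = ∏ i, (Polynomial.X - Polynomial.C ((d i : ℂ) * d i)) := by
    rw [hAA, charpoly_mul_comm, ← Matrix.mul_assoc, hU', Matrix.one_mul, diagonal_mul_diagonal,
      charpoly_diagonal]
  rw [hchar, Polynomial.roots_prod _ _ (by
      simp [Finset.prod_ne_zero_iff, Polynomial.X_sub_C_ne_zero, -map_mul])] at hroots
  simp only [Polynomial.roots_X_sub_C, Multiset.bind_singleton] at hroots
  obtain ⟨σ, hσ⟩ := exists_perm_of_map_univ_eq hroots.symm
  refine ⟨σ, fun i => ?_⟩
  have h1 : hH.eigenvalues (σ i) = d i * d i := by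
    have := hσ i
    simp only [Function.comp] at this
    exact Complex.ofReal_injective (by rw [Complex.ofReal_mul]; exact this)
  change Real.sqrt (hH.eigenvalues (σ i)) = d i
  rw [h1, Real.sqrt_mul_self (hd i)]

instance unitaryGroup.compactSpace {n : ℕ} : CompactSpace (unitaryGroup (Fin n) ℂ) := by
  refine isCompact_iff_compactSpace (s := ((unitaryGroup (Fin n) ℂ : Submonoid _) : Set (Matrix (Fin n) (Fin n) ℂ))).1 ?_
  have hK : IsCompact (Set.univ.pi fun _ : Fin n => Set.univ.pi fun _ : Fin n =>
      Metric.closedBall (0 : ℂ) 1) :=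
    isCompact_univ_pi fun _ => isCompact_univ_pi fun _ => isCompact_closedBall _ _
  refine IsCompact.of_isClosed_subset hK ?_ ?_
  · have : ((unitaryGroup (Fin n) ℂ : Submonoid _) : Set (Matrix (Fin n) (Fin n) ℂ))
        = {A | A * star A = 1} := Set.ext fun A => mem_unitaryGroup_iff
    rw [this]
    exact isClosed_eq (by fun_prop) continuous_const
  · intro A hA i _ j _
    simpa using entry_norm_bound_of_unitary hA i j

end Matrix

section Amoeba

variable {n : ℕ} {f : Matrix (Fin n) (Fin n) ℂ → ℂ}

theorem mem_sAmoeba_iff {x : Fin n → ℝ} :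
    x ∈ sAmoeba f ↔ ∃ U V : unitaryGroup (Fin n) ℂ,
      f (U.1 * diagonal (fun i => (Real.exp (x i) : ℂ)) * V.1) = 0 := by
  constructor
  · rintro ⟨A, hA, hfA, σ, hσ⟩
    obtain ⟨U, hU, V, hV, hUV⟩ := exists_unitary_mul_diagonal_singularValues_mul hA
    have hd : (fun i => (Real.exp (x i) : ℂ)) = (fun i => (singularValues A i : ℂ)) ∘ σ := by
      funext i
      simp only [Function.comp, hσ]
    refine ⟨⟨U.submatrix id σ, ?_⟩, ⟨V.submatrix σ id, ?_⟩, ?_⟩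
    · rw [mem_unitaryGroup_iff', star_eq_conjTranspose, conjTranspose_submatrix,
        ← submatrix_mul _ _ _ _ _ Function.bijective_id, ← star_eq_conjTranspose,
        mem_unitaryGroup_iff'.1 hU]
      simp
    · rw [mem_unitaryGroup_iff, star_eq_conjTranspose, conjTranspose_submatrix,
        ← submatrix_mul _ _ _ _ _ Function.bijective_id, ← star_eq_conjTranspose,
        mem_unitaryGroup_iff.1 hV]
      simp
    · rw [hd, mul_diagonal_mul_submatrix_perm, ← hUV, hfA]
  · rintro ⟨U, V, h⟩
    refine ⟨_, ?_, h, exists_perm_singularValues_unitary_mul_diagonal_mul U.2 V.2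
      fun i => (Real.exp_pos _).le⟩
    rw [det_mul, det_mul, det_diagonal]
    refine ((UnitaryGroup.det_isUnit U).mul ?_).mul (UnitaryGroup.det_isUnit V)
    exact isUnit_iff_ne_zero.2 (Finset.prod_ne_zero_iff.2 fun i _ =>
      Complex.ofReal_ne_zero.2 (Real.exp_pos _).ne')

theorem isClosed_sAmoeba (hf : Continuous f) : IsClosed (sAmoeba f) := by
  have hcl : IsClosed {p : (unitaryGroup (Fin n) ℂ × unitaryGroup (Fin n) ℂ) × (Fin n → ℝ) |
      f (p.1.1.1 * diagonal (fun i => (Real.exp (p.2 i) : ℂ)) * p.1.2.1) = 0} := by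
    refine isClosed_eq (hf.comp ?_) continuous_const
    refine (Continuous.matrix_mul (by fun_prop) (Continuous.matrix_diagonal ?_)).matrix_mul
      (by fun_prop)
    fun_prop
  convert isClosedMap_snd_of_compactSpace _ hcl
  ext x
  rw [mem_sAmoeba_iff]
  constructor
  · rintro ⟨U, V, h⟩
    exact ⟨((U, V), x), h, rfl⟩
  · rintro ⟨⟨⟨U, V⟩, y⟩, h, rfl⟩
    exact ⟨U, V, h⟩

end Amoeba

section ZeroCount

open Polynomial

theorem circleIntegral_inv_sub {R : ℝ} (hR : 0 ≤ R) {a : ℂ} (ha : ‖a‖ ≠ R) :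
    (∮ z in C(0, R), (z - a)⁻¹)
      = 2 * Real.pi * Complex.I * (if ‖a‖ < R then 1 else 0) := by
  split_ifs with h
  · rw [circleIntegral.integral_sub_inv_of_mem_ball (by simpa using h), mul_one]
  · have hlt : R < ‖a‖ := lt_of_le_of_ne (not_lt.1 h) ha.symm
    have hne : ∀ z ∈ Metric.closedBall (0 : ℂ) R, z - a ≠ 0 := fun z hz h0 => by
      rw [sub_eq_zero.1 h0] at hz
      exact absurd (by simpa using hz) (not_le.2 hlt)
    rw [mul_zero]
    refine Complex.circleIntegral_eq_zero_of_differentiable_on_off_countable hR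
      Set.countable_empty (ContinuousOn.inv₀ (by fun_prop) hne) fun z hz => ?_
    exact DifferentiableAt.inv (by fun_prop) (hne z (Metric.ball_subset_closedBall hz.1))

theorem circleIntegral_sum_inv_sub {R : ℝ} (hR : 0 ≤ R) (s : Multiset ℂ)
    (hs : ∀ a ∈ s, ‖a‖ ≠ R) :
    CircleIntegrable (fun z => (s.map fun a => (z - a)⁻¹).sum) 0 R ∧
    (∮ z in C(0, R), (s.map fun a => (z - a)⁻¹).sum)
      = 2 * Real.pi * Complex.I * (s.countP fun a => ‖a‖ < R) := by
  induction s using Multiset.induction_on with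
  | empty => simp [CircleIntegrable, circleIntegral]
  | cons a s ih =>
    obtain ⟨ih1, ih2⟩ := ih fun b hb => hs b (Multiset.mem_cons_of_mem hb)
    have ha := hs a (Multiset.mem_cons_self a s)
    have hi : CircleIntegrable (fun z => (z - a)⁻¹) 0 R := by
      refine ContinuousOn.circleIntegrable hR (ContinuousOn.inv₀ (by fun_prop) fun z hz h0 => ha ?_)
      rw [← sub_eq_zero.1 h0]
      simpa using hz
    simp only [Multiset.map_cons, Multiset.sum_cons]
    refine ⟨hi.add ih1, ?_⟩
    rw [circleIntegral.integral_add hi ih1, ih2, circleIntegral_inv_sub hR ha,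
      Multiset.countP_cons]
    push_cast
    ring

/-- The argument principle for polynomials on a circle centred at the origin. -/
theorem Polynomial.circleIntegral_derivative_div {R : ℝ} (hR : 0 ≤ R) {q : ℂ[X]}
    (hq : ∀ z, ‖z‖ = R → q.eval z ≠ 0) :
    (∮ z in C(0, R), q.derivative.eval z / q.eval z)
      = 2 * Real.pi * Complex.I * (q.roots.countP fun a => ‖a‖ < R) := by
  rw [← (circleIntegral_sum_inv_sub hR q.roots fun a ha h =>
    hq a h (isRoot_of_mem_roots ha)).2]
  refine circleIntegral.integral_congr hR fun z hz => ?_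
  simpa using (IsAlgClosed.splits q).eval_derivative_div_eval_of_ne_zero
    (hq z (by simpa using hz))

theorem Polynomial.continuous_eval_map_eval {σ : Type*} (q : (MvPolynomial σ ℂ)[X]) :
    Continuous fun p : (σ → ℂ) × ℂ => (q.map (MvPolynomial.eval p.1)).eval p.2 := by
  simp only [eval_map, eval₂_eq_sum_range]
  refine continuous_finsetSum _ fun i _ => Continuous.mul ?_ (by fun_prop)
  exact (MvPolynomial.continuous_eval _).comp continuous_fst

/-- In a family of polynomials without zeros on the unit circle, parametrized continuously by a
preconnected set, the number of zeros in the unit disc is constant. -/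
theorem Polynomial.countP_roots_map_eval_eq {X σ : Type*} [TopologicalSpace X]
    (q : (MvPolynomial σ ℂ)[X]) {y : X → σ → ℂ} (hy : Continuous y) {C : Set X}
    (hC : IsPreconnected C)
    (hq : ∀ x ∈ C, ∀ z : ℂ, ‖z‖ = 1 → (q.map (MvPolynomial.eval (y x))).eval z ≠ 0)
    {a b : X} (ha : a ∈ C) (hb : b ∈ C) :
    (q.map (MvPolynomial.eval (y a))).roots.countP (fun z => ‖z‖ < 1)
      = (q.map (MvPolynomial.eval (y b))).roots.countP (fun z => ‖z‖ < 1) := by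
  have hconn : PreconnectedSpace C := isPreconnected_iff_preconnectedSpace.1 hC
  let N : C → ℕ := fun x =>
    (q.map (MvPolynomial.eval (y x))).roots.countP (fun z => ‖z‖ < 1)
  have hN : ∀ x : C, (2 * Real.pi * Complex.I)⁻¹ * (∮ z in C(0, 1),
      (q.map (MvPolynomial.eval (y x))).derivative.eval z /
        (q.map (MvPolynomial.eval (y x))).eval z) = N x := fun x => by
    rw [circleIntegral_derivative_div zero_le_one (hq x x.2),
      inv_mul_cancel_left₀ Complex.two_pi_I_ne_zero]
  have hcircle : ∀ θ : ℝ, ‖circleMap 0 1 θ‖ = 1 := fun θ => by simp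
  have hint : Continuous fun x : C => ∮ z in C(0, 1),
      (q.map (MvPolynomial.eval (y x))).derivative.eval z /
        (q.map (MvPolynomial.eval (y x))).eval z := by
    unfold circleIntegral
    refine intervalIntegral.continuous_parametric_intervalIntegral_of_continuous' ?_ _ _
    have hpair : Continuous fun p : C × ℝ => (y p.1, circleMap 0 1 p.2) := by fun_prop
    refine Continuous.smul (f := fun p : C × ℝ => deriv (circleMap 0 1) p.2) ?_
      (Continuous.div ?_ ?_ fun p => hq _ p.1.2 _ (hcircle _))
    · simp only [deriv_circleMap]
      fun_prop
    · simp only [derivative_map]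
      exact (continuous_eval_map_eval q.derivative).comp hpair
    · exact (continuous_eval_map_eval q).comp hpair
  have hNc : Continuous N := by
    rw [Nat.isClosedEmbedding_coe_real.isEmbedding.continuous_iff]
    have := Complex.continuous_re.comp (hint.const_mul ((2 * Real.pi * Complex.I : ℂ)⁻¹))
    convert this using 1
    funext x
    rw [Function.comp, Function.comp, hN x, Complex.natCast_re]
  exact hconn.constant hNc (x := ⟨a, ha⟩) (y := ⟨b, hb⟩)

/-- Two polynomials that are proportional up to scaling of the variable by `ρ`: the roots of the
second in the unit disc correspond to the roots of the first in the disc of radius `ρ`. -/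
theorem Polynomial.countP_roots_eq_of_eval_scale {p q : ℂ[X]} {ρ : ℝ} (hρ : 0 < ρ) {c : ℂ}
    (hc : c ≠ 0) (h : ∀ z : ℂ, z ≠ 0 → q.eval z = c * p.eval (ρ * z)) :
    q.roots.countP (fun z => ‖z‖ < 1) = p.roots.countP (fun z => ‖z‖ < ρ) := by
  have hρ' : (ρ : ℂ) ≠ 0 := Complex.ofReal_ne_zero.2 hρ.ne'
  have hpq : q = C c * p.comp (C (ρ : ℂ) * X + C 0) := by
    refine Polynomial.eq_of_infinite_eval_eq _ _
      ((Set.finite_singleton (0 : ℂ)).infinite_compl.mono fun z hz => ?_)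
    simp [h z hz]
  rw [← p.map_roots_comp_C_mul_X_add_C (ρ : ℂ) 0 (isUnit_iff_ne_zero.2 hρ'),
    Multiset.countP_map, hpq, roots_C_mul _ hc, Multiset.countP_eq_card_filter]
  congr 1
  refine Multiset.filter_congr fun z _ => ?_
  simp [abs_of_pos hρ, hρ]

/-- A nonvanishing criterion on an annulus from the equality of the zero counts. -/
theorem Polynomial.eval_ne_zero_of_countP_roots_eq {p : ℂ[X]} (hp : p ≠ 0) {r s : ℝ} (hrs : r ≤ s)
    (h : p.roots.countP (fun z => ‖z‖ < r) = p.roots.countP (fun z => ‖z‖ < s)) {z : ℂ}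
    (hz : r ≤ ‖z‖) (hz' : ‖z‖ < s) : p.eval z ≠ 0 := by
  intro h0
  have hmem : z ∈ p.roots.filter (fun z => ‖z‖ < s) :=
    Multiset.mem_filter.2 ⟨(mem_roots hp).2 h0, hz'⟩
  rw [Multiset.countP_eq_card_filter, Multiset.countP_eq_card_filter] at h
  rw [← Multiset.eq_of_le_of_card_le
    (Multiset.monotone_filter_right _ fun w hw => lt_of_lt_of_le hw hrs) h.ge] at hmem
  exact absurd (Multiset.mem_filter.1 hmem).2 (not_lt.2 hz)

end ZeroCount

section Laurent

open Polynomial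

/-- A polynomial expression in the entries of `U * diagonal (y * t ^ v) * V` is, up to a power
of `t`, a polynomial in `t` with coefficients polynomial in `y`. -/
theorem exists_polynomial_eval_mul_diagonal_zpow_mul {m : Type*} [Fintype m] [DecidableEq m]
    (P : MvPolynomial (m × m) ℂ) (U V : Matrix m m ℂ) (v : m → ℤ) :
    ∃ (K : ℕ) (q : (MvPolynomial m ℂ)[X]), ∀ (y : m → ℂ) (t : ℂ), t ≠ 0 →
      (q.map (MvPolynomial.eval y)).eval t = t ^ K * MvPolynomial.eval
        (fun p => (U * diagonal (fun k => y k * t ^ v k) * V) p.1 p.2) P := by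
  induction P using MvPolynomial.induction_on with
  | C a => exact ⟨0, C (MvPolynomial.C a), fun y t _ => by simp⟩
  | add P₁ P₂ h₁ h₂ =>
    obtain ⟨K₁, q₁, h₁⟩ := h₁
    obtain ⟨K₂, q₂, h₂⟩ := h₂
    refine ⟨K₁ + K₂, X ^ K₂ * q₁ + X ^ K₁ * q₂, fun y t ht => ?_⟩
    simp only [Polynomial.map_add, Polynomial.map_mul, Polynomial.map_pow, map_X, eval_add,
      eval_mul, eval_pow, eval_X, h₁ y t ht, h₂ y t ht, map_add]
    ring
  | mul_X P ij h =>
    obtain ⟨K, q, h⟩ := h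
    set M : ℕ := ∑ k, (v k).natAbs
    have hv : ∀ k, 0 ≤ M + v k := fun k => by
      have : (v k).natAbs ≤ M :=
        Finset.single_le_sum (f := fun k => (v k).natAbs) (fun _ _ => Nat.zero_le _)
          (Finset.mem_univ k)
      omega
    refine ⟨K + M, q * ∑ k, C (MvPolynomial.C (U ij.1 k * V k ij.2) * MvPolynomial.X k)
      * X ^ (M + v k).toNat, fun y t ht => ?_⟩
    have hpow : ∀ k, t ^ (M + v k).toNat = t ^ M * t ^ v k := fun k => by
      rw [← zpow_natCast, Int.toNat_of_nonneg (hv k), zpow_add₀ ht, zpow_natCast]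
    simp only [Polynomial.map_mul, Polynomial.map_sum, Polynomial.map_pow, map_X, map_C, eval_mul,
      eval_finsetSum, eval_pow, eval_X, eval_C, h y t ht, map_mul, MvPolynomial.eval_C,
      MvPolynomial.eval_X, hpow, Matrix.mul_apply (M := _ * _), Matrix.mul_diagonal, pow_add]
    have hsum : ∑ k, U ij.1 k * V k ij.2 * y k * (t ^ M * t ^ v k)
        = t ^ M * ∑ k, U ij.1 k * (y k * t ^ v k) * V k ij.2 := by
      rw [Finset.mul_sum]
      exact Finset.sum_congr rfl fun k _ => by ring
    rw [hsum]
    ring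

end Laurent

section Convexity

variable {n : ℕ} {f : Matrix (Fin n) (Fin n) ℂ → ℂ}

theorem apply_mul_diagonal_exp_zpow_mul_ne_zero {x : Fin n → ℝ} (hx : x ∉ sAmoeba f)
    (U V : unitaryGroup (Fin n) ℂ) (v : Fin n → ℤ) {t : ℂ} (ht : ‖t‖ = 1) :
    f (U.1 * diagonal (fun k => (Real.exp (x k) : ℂ) * t ^ v k) * V.1) ≠ 0 := by
  intro h0
  have hD : diagonal (fun k => t ^ v k) ∈ unitaryGroup (Fin n) ℂ := by
    rw [mem_unitaryGroup_iff, star_eq_conjTranspose, diagonal_conjTranspose, diagonal_mul_diagonal,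
      ← diagonal_one]
    congr 1
    funext k
    have : ‖t ^ v k‖ = 1 := by rw [norm_zpow, ht, _root_.one_zpow]
    simpa [this] using Complex.mul_conj' (t ^ v k)
  refine hx (mem_sAmoeba_iff.2 ⟨U, ⟨_, hD⟩ * V, ?_⟩)
  rw [← h0, ← diagonal_mul_diagonal]
  simp only [Submonoid.coe_mul, Matrix.mul_assoc]

/-- Two points of a preconnected subset of the complement of the amoeba whose difference has
rational direction are joined by a segment in the complement. -/
theorem add_mul_notMem_sAmoeba {P : MvPolynomial (Fin n × Fin n) ℂ}
    (hf : ∀ A, f A = MvPolynomial.eval (fun p => A p.1 p.2) P) {C : Set (Fin n → ℝ)}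
    (hC : IsPreconnected C) (hCS : C ⊆ (sAmoeba f)ᶜ) (v : Fin n → ℤ) {x : Fin n → ℝ} {s r : ℝ}
    (hx : x ∈ C) (hxs : (fun i => x i + s * v i) ∈ C) (hr : 0 ≤ r) (hrs : r ≤ s) :
    (fun i => x i + r * v i) ∉ sAmoeba f := by
  rcases hrs.eq_or_lt with rfl | hrs
  · exact hCS hxs
  intro hmem
  obtain ⟨U, V, h0⟩ := mem_sAmoeba_iff.1 hmem
  obtain ⟨K, q, hq⟩ := exists_polynomial_eval_mul_diagonal_zpow_mul P U.1 V.1 v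
  simp only [← hf] at hq
  let y : (Fin n → ℝ) → Fin n → ℂ := fun x k => (Real.exp (x k) : ℂ)
  have hy : Continuous y := by fun_prop
  have hshift : ∀ (ρ : ℝ) (z : ℂ), (fun k => y (fun i => x i + ρ * v i) k * z ^ v k)
      = fun k => y x k * ((Real.exp ρ : ℝ) * z) ^ v k := fun ρ z => by
    funext k
    simp only [y, mul_zpow, Real.exp_add, Complex.ofReal_mul, mul_assoc]
    rw [Real.exp_mul, Real.rpow_intCast, Complex.ofReal_zpow]
  have hne : ∀ x ∈ C, ∀ z : ℂ, ‖z‖ = 1 → (q.map (MvPolynomial.eval (y x))).eval z ≠ 0 :=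
    fun x hx z hz => by
      have hz0 : z ≠ 0 := norm_ne_zero_iff.1 (by rw [hz]; exact one_ne_zero)
      rw [hq _ _ hz0]
      exact mul_ne_zero (pow_ne_zero _ hz0)
        (apply_mul_diagonal_exp_zpow_mul_ne_zero (hCS hx) U V v hz)
  have hexp : ∀ ρ : ℝ, ((Real.exp ρ : ℝ) : ℂ) ≠ 0 := fun ρ =>
    Complex.ofReal_ne_zero.2 (Real.exp_pos ρ).ne'
  have hscale := Polynomial.countP_roots_eq_of_eval_scale
    (p := q.map (MvPolynomial.eval (y x)))
    (q := q.map (MvPolynomial.eval (y fun i => x i + s * v i))) (Real.exp_pos s)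
    (inv_ne_zero (pow_ne_zero K (hexp s))) fun z hz => by
      rw [hq _ _ hz, hq _ _ (mul_ne_zero (hexp s) hz), hshift, mul_pow,
        mul_assoc (_ ^ K),
        inv_mul_cancel_left₀ (pow_ne_zero K (hexp s))]
  have hcount := Polynomial.countP_roots_map_eval_eq q hy hC hne hx hxs
  have hp : q.map (MvPolynomial.eval (y x)) ≠ 0 := fun h =>
    hne x hx 1 norm_one (by rw [h, Polynomial.eval_zero])
  refine Polynomial.eval_ne_zero_of_countP_roots_eq hp
    (Real.one_le_exp (hr.trans hrs.le)) (hcount.trans hscale) (z := (Real.exp r : ℝ)) ?_ ?_ ?_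
  · rw [Complex.norm_real, Real.norm_of_nonneg (Real.exp_pos r).le]
    exact Real.one_le_exp hr
  · rw [Complex.norm_real, Real.norm_of_nonneg (Real.exp_pos r).le]
    exact Real.exp_lt_exp.2 hrs
  · have := hshift r 1
    simp only [_root_.one_zpow, mul_one] at this
    rw [hq _ _ (hexp r), ← this, h0, mul_zero]

theorem exists_natCast_mul_eq_intCast {ι : Type*} [Fintype ι] (d : ι → ℚ) :
    ∃ (N : ℕ) (v : ι → ℤ), 0 < N ∧ ∀ i, (N : ℝ) * d i = v i := by
  have hdvd : ∀ i, ∃ k, ∏ j, (d j).den = (d i).den * k := fun i =>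
    Finset.dvd_prod_of_mem _ (Finset.mem_univ i)
  choose k hk using hdvd
  refine ⟨∏ j, (d j).den, fun i => (d i).num * k i, Finset.prod_pos fun i _ => (d i).pos,
    fun i => ?_⟩
  have h : ((∏ j, (d j).den : ℕ) : ℚ) * d i = ((d i).num * k i : ℤ) := by
    have := Rat.mul_den_eq_num (d i)
    rw [hk i]
    push_cast
    linear_combination (k i : ℚ) * this
  exact_mod_cast h

/-- Any point of the segment between two points of an open set `C` lies on a segment of rational
direction with endpoints in `C`. -/
theorem exists_int_direction {ι : Type*} [Fintype ι] {C : Set (ι → ℝ)} (hC : IsOpen C)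
    {x y w : ι → ℝ} (hx : x ∈ C) (hy : y ∈ C) (hw : w ∈ segment ℝ x y) :
    ∃ (x' : ι → ℝ) (v : ι → ℤ) (s r : ℝ), 0 ≤ r ∧ r ≤ s ∧ x' ∈ C ∧
      (fun i => x' i + s * v i) ∈ C ∧ w = fun i => x' i + r * v i := by
  rw [segment_eq_image'] at hw
  obtain ⟨c, ⟨hc0, hc1⟩, rfl⟩ := hw
  dsimp only
  set w := x + c • (y - x)
  have hopen : IsOpen {d : ι → ℝ | w - c • d ∈ C ∧ w + (1 - c) • d ∈ C} :=
    (hC.preimage (by fun_prop)).inter (hC.preimage (by fun_prop))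
  have hmem : y - x ∈ {d : ι → ℝ | w - c • d ∈ C ∧ w + (1 - c) • d ∈ C} := by
    refine ⟨?_, ?_⟩
    · simpa [w] using hx
    · have : w + (1 - c) • (y - x) = y := by
        simp only [w]
        module
      rwa [this]
  obtain ⟨d, hd1, hd2⟩ := (DenseRange.piMap fun _ : ι => Rat.denseRange_cast (𝕜 := ℝ)).exists_mem_open
    hopen ⟨_, hmem⟩
  obtain ⟨N, v, hN, hv⟩ := exists_natCast_mul_eq_intCast d
  have hN' : (0 : ℝ) < N := Nat.cast_pos.2 hN
  have hdv : ∀ i, (d i : ℝ) = (N : ℝ)⁻¹ * v i := fun i => by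
    rw [← hv i, inv_mul_cancel_left₀ hN'.ne']
  refine ⟨_, v, (N : ℝ)⁻¹, c * (N : ℝ)⁻¹, by positivity,
    mul_le_of_le_one_left (by positivity) hc1, hd1, ?_, ?_⟩
  · convert hd2 using 1
    funext i
    simp only [Pi.add_apply, Pi.sub_apply, Pi.smul_apply, Pi.map_apply, smul_eq_mul, hdv]
    ring
  · funext i
    simp only [Pi.sub_apply, Pi.smul_apply, Pi.map_apply, smul_eq_mul, hdv]
    ring

end Convexity

/-- For a polynomial function `f` on `Mat_n(ℂ)`, every connected component of the complement
of the matrix amoeba of `f` is convex. -/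
theorem stmt4 {n : ℕ} (f : Matrix (Fin n) (Fin n) ℂ → ℂ)
    (P : MvPolynomial (Fin n × Fin n) ℂ)
    (hf : ∀ A, f A = MvPolynomial.eval (fun p => A p.1 p.2) P) :
    ∀ x ∉ sAmoeba f, Convex ℝ (connectedComponentIn (sAmoeba f)ᶜ x) := by
  intro x₀ _
  have hcont : Continuous f := by
    rw [funext hf]
    exact (MvPolynomial.continuous_eval P).comp (by fun_prop)
  have hopen : IsOpen (connectedComponentIn (sAmoeba f)ᶜ x₀) :=
    (isClosed_sAmoeba hcont).isOpen_compl.connectedComponentIn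
  rw [convex_iff_segment_subset]
  intro x hx y hy
  have hsub : segment ℝ x y ⊆ (sAmoeba f)ᶜ := fun w hw => by
    obtain ⟨x', v, s, r, hr, hrs, hx', hxs, rfl⟩ := exists_int_direction hopen hx hy hw
    exact add_mul_notMem_sAmoeba hf isPreconnected_connectedComponentIn
      (connectedComponentIn_subset _ _) v hx' hxs hr hrs
  rw [connectedComponentIn_eq hx]
  exact (convex_segment x y).isPreconnected.subset_connectedComponentIn
    (left_mem_segment ℝ x y) hsub
end

section
/- Let f : GL_n(ℂ) → ℂ and let (Q_m)_{m ∈ ℤⁿ} be a finitely supported family of functions GL_n(ℂ) × GL_n(ℂ) → ℂ such that for all invertible A, B ∈ GL_n(ℂ) and all z ∈ (ℂ∖{0})ⁿ one has f(A·diag(z)·B⁻¹) = Σ_{m ∈ ℤⁿ} Q_m(A,B)·z^m, where z^m = ∏_i z_i^{m_i} (integer powers). Then for all m ∈ ℤⁿ, all invertible A, B, all λ ∈ (ℂ∖{0})ⁿ, and every permutation σ of {1,…,n} with permutation matrix P_σ: (a) Q_m(A·diag(λ), B) = λ^m·Q_m(A,B); (b) Q_m(A, B·diag(λ)) = λ^{−m}·Q_m(A,B);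 (c) Q_m(A·P_σ, B·P_σ) = Q_{σ·m}(A,B), where σ·m is the vector with (σ·m)_{σ(i)} = m_i for all i. -/
open Matrix

/-- The permutation matrix of `σ`, characterized by `P_σ · diag z · P_σ⁻¹ = diag (σ · z)`,
i.e. `P_σ` sends the `j`-th basis vector to the `σ j`-th basis vector. -/
def permMat {n : ℕ} (σ : Equiv.Perm (Fin n)) : Matrix (Fin n) (Fin n) ℂ :=
  Matrix.of fun i j => if σ j = i then 1 else 0

/-- The character `z ↦ z ^ m` of the torus `(ℂˣ)ⁿ`. -/
noncomputable def torusCharacter {n : ℕ} (m : Fin n → ℤ) : (Fin n → ℂˣ) →* ℂ where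
  toFun z := ∏ i, (z i : ℂ) ^ m i
  map_one' := by simp
  map_mul' z w := by simp [mul_zpow, Finset.prod_mul_distrib]

theorem torusCharacter_apply {n : ℕ} (m : Fin n → ℤ) (z : Fin n → ℂˣ) :
    torusCharacter m z = ∏ i, (z i : ℂ) ^ m i := rfl

theorem torusCharacter_injective {n : ℕ} :
    Function.Injective (torusCharacter : (Fin n → ℤ) → (Fin n → ℂˣ) →* ℂ) := by
  intro m k h
  funext i
  have key : ∀ p : Fin n → ℤ,
      torusCharacter p (Pi.mulSingle i (Units.mk0 2 two_ne_zero)) = (2 : ℂ) ^ p i := by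
    intro p
    rw [torusCharacter_apply, Finset.prod_eq_single i]
    · simp
    · intro j _ hj
      simp [Pi.mulSingle_eq_of_ne hj]
    · simp
  have h2 : (2 : ℂ) ^ m i = (2 : ℂ) ^ k i := by rw [← key, ← key, h]
  have h3 : (2 : ℝ) ^ m i = (2 : ℝ) ^ k i := by
    apply Complex.ofReal_injective
    simpa using h2
  exact zpow_right_injective₀ (by norm_num) (by norm_num) h3

/-- The coefficients of a Laurent polynomial are determined by its values on the torus. -/
theorem laurent_coeff_unique {n : ℕ} {c d : (Fin n → ℤ) → ℂ}
    (hc : c.support.Finite) (hd : d.support.Finite)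
    (h : ∀ z : Fin n → ℂ, (∀ i, z i ≠ 0) →
      ∑ᶠ m : Fin n → ℤ, c m * ∏ i, z i ^ m i = ∑ᶠ m : Fin n → ℤ, d m * ∏ i, z i ^ m i) :
    c = d := by
  have hli : LinearIndependent ℂ
      (fun m : Fin n → ℤ => (torusCharacter m : (Fin n → ℂˣ) → ℂ)) :=
    (linearIndependent_monoidHom (Fin n → ℂˣ) ℂ).comp _ torusCharacter_injective
  set s : Finset (Fin n → ℤ) := (hc.union hd).toFinset with hs
  have hsum : ∑ m ∈ s, (c m - d m) • (torusCharacter m : (Fin n → ℂˣ) → ℂ) = 0 := by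
    funext z
    have hz := h (fun i => (z i : ℂ)) (fun i => (z i).ne_zero)
    rw [finsum_eq_sum_of_support_subset (s := s), finsum_eq_sum_of_support_subset (s := s)] at hz
    · simp only [Finset.sum_apply, Pi.smul_apply, smul_eq_mul, sub_mul, Finset.sum_sub_distrib,
        torusCharacter_apply, Pi.zero_apply]
      exact sub_eq_zero.mpr hz
    · intro m hm
      simp only [hs, Set.Finite.coe_toFinset]
      exact Or.inr (left_ne_zero_of_mul hm)
    · intro m hm
      simp only [hs, Set.Finite.coe_toFinset]
      exact Or.inl (left_ne_zero_of_mul hm)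
  funext m
  by_cases hm : m ∈ s
  · exact sub_eq_zero.mp (linearIndependent_iff'.mp hli s _ hsum m hm)
  · simp only [hs, Set.Finite.mem_toFinset, Set.mem_union, Function.mem_support] at hm
    push Not at hm
    rw [hm.1, hm.2]

theorem permMat_mul_permMat_inv {n : ℕ} (σ : Equiv.Perm (Fin n)) :
    permMat σ * permMat σ⁻¹ = 1 := by
  ext i j
  simp [permMat, Matrix.mul_apply, Matrix.one_apply, eq_comm]

theorem isUnit_det_permMat {n : ℕ} (σ : Equiv.Perm (Fin n)) : IsUnit (permMat σ).det :=
  Matrix.isUnit_det_of_right_inverse (permMat_mul_permMat_inv σ)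

theorem permMat_mul_diagonal {n : ℕ} (σ : Equiv.Perm (Fin n)) (z : Fin n → ℂ) :
    permMat σ * Matrix.diagonal z = Matrix.diagonal (fun j => z (σ⁻¹ j)) * permMat σ := by
  ext i j
  rw [Matrix.mul_diagonal, Matrix.diagonal_mul]
  by_cases h : σ j = i
  · subst h
    simp [permMat]
  · simp [permMat, h]

theorem isUnit_det_diagonal {n : ℕ} {l : Fin n → ℂ} (hl : ∀ i, l i ≠ 0) :
    IsUnit (Matrix.diagonal l).det := by
  rw [Matrix.det_diagonal]
  exact isUnit_iff_ne_zero.mpr (Finset.prod_ne_zero_iff.mpr fun i _ => hl i)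

/-- Homogeneity and permutation-equivariance of the Laurent coefficients `Q_m` of a function
`f` on `GL_n(ℂ)` with respect to the expansion
`f (A · diag z · B⁻¹) = Σ_m Q_m (A, B) · z ^ m`. -/
theorem stmt8 {n : ℕ} (f : Matrix (Fin n) (Fin n) ℂ → ℂ)
    (Q : (Fin n → ℤ) → Matrix (Fin n) (Fin n) ℂ → Matrix (Fin n) (Fin n) ℂ → ℂ)
    (hfin : {m : Fin n → ℤ | Q m ≠ 0}.Finite)
    (hexp : ∀ A B : Matrix (Fin n) (Fin n) ℂ, IsUnit A.det → IsUnit B.det →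
      ∀ z : Fin n → ℂ, (∀ i, z i ≠ 0) →
        f (A * Matrix.diagonal z * B⁻¹) = ∑ᶠ m : Fin n → ℤ, Q m A B * ∏ i, z i ^ m i) :
    ∀ (m : Fin n → ℤ) (A B : Matrix (Fin n) (Fin n) ℂ), IsUnit A.det → IsUnit B.det →
      (∀ l : Fin n → ℂ, (∀ i, l i ≠ 0) →
        Q m (A * Matrix.diagonal l) B = (∏ i, l i ^ m i) * Q m A B ∧
        Q m A (B * Matrix.diagonal l) = (∏ i, l i ^ (-(m i))) * Q m A B) ∧
      (∀ σ : Equiv.Perm (Fin n),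
        Q m (A * permMat σ) (B * permMat σ) = Q (fun j => m (σ⁻¹ j)) A B) := by
  have hsupp : ∀ A B, (fun m => Q m A B).support.Finite := fun A B =>
    hfin.subset fun m hm h0 => hm (by simp [h0])
  intro m A B hA hB
  refine ⟨fun l hl => ⟨?_, ?_⟩, fun σ => ?_⟩
  · have hAl : IsUnit (A * Matrix.diagonal l).det := by
      rw [Matrix.det_mul]
      exact hA.mul (isUnit_det_diagonal hl)
    refine congrFun (laurent_coeff_unique (c := fun m => Q m (A * Matrix.diagonal l) B)
      (d := fun m => (∏ i, l i ^ m i) * Q m A B) (hsupp _ _)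
      ((hsupp A B).subset fun m hm => right_ne_zero_of_mul hm) fun z hz => ?_) m
    rw [← hexp _ B hAl hB z hz, Matrix.mul_assoc A, Matrix.diagonal_mul_diagonal,
      hexp A B hA hB _ fun i => mul_ne_zero (hl i) (hz i)]
    refine finsum_congr fun k => ?_
    simp only [mul_zpow, Finset.prod_mul_distrib]
    ring
  · have hBl : IsUnit (B * Matrix.diagonal l).det := by
      rw [Matrix.det_mul]
      exact hB.mul (isUnit_det_diagonal hl)
    have hinv : (Matrix.diagonal l)⁻¹ = Matrix.diagonal fun i => (l i)⁻¹ := by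
      refine Matrix.inv_eq_right_inv ?_
      simp [Matrix.diagonal_mul_diagonal, hl]
    refine congrFun (laurent_coeff_unique (c := fun m => Q m A (B * Matrix.diagonal l))
      (d := fun m => (∏ i, l i ^ (-(m i))) * Q m A B) (hsupp _ _)
      ((hsupp A B).subset fun m hm => right_ne_zero_of_mul hm) fun z hz => ?_) m
    rw [← hexp A _ hA hBl z hz, Matrix.mul_inv_rev, hinv, ← Matrix.mul_assoc, Matrix.mul_assoc A,
      Matrix.diagonal_mul_diagonal,
      hexp A B hA hB _ fun i => mul_ne_zero (hz i) (inv_ne_zero (hl i))]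
    refine finsum_congr fun k => ?_
    simp only [mul_zpow, _root_.inv_zpow', Finset.prod_mul_distrib]
    ring
  · have hP := isUnit_det_permMat σ
    have hAP : IsUnit (A * permMat σ).det := by
      rw [Matrix.det_mul]
      exact hA.mul hP
    have hBP : IsUnit (B * permMat σ).det := by
      rw [Matrix.det_mul]
      exact hB.mul hP
    let e : (Fin n → ℤ) ≃ (Fin n → ℤ) := Equiv.arrowCongr σ (Equiv.refl ℤ)
    have he : ∀ k j, e k j = k (σ⁻¹ j) := fun _ _ => rfl
    refine congrFun (laurent_coeff_unique
      (c := fun m => Q m (A * permMat σ) (B * permMat σ))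
      (d := fun m => Q (e m) A B) (hsupp _ _)
      ((hsupp A B).preimage e.injective.injOn) fun z hz => ?_) m
    have hmat : A * permMat σ * Matrix.diagonal z * (B * permMat σ)⁻¹ =
        A * Matrix.diagonal (fun j => z (σ⁻¹ j)) * B⁻¹ := by
      rw [Matrix.mul_inv_rev, Matrix.mul_assoc A, permMat_mul_diagonal, ← Matrix.mul_assoc,
        ← Matrix.mul_assoc A, Matrix.mul_nonsing_inv_cancel_right _ _ hP]
    rw [← hexp _ _ hAP hBP z hz, hmat, hexp A B hA hB _ fun j => hz (σ⁻¹ j),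
      ← finsum_comp_equiv e]
    refine finsum_congr fun k => ?_
    simp only [he]
    rw [Equiv.prod_comp σ⁻¹ fun i => z i ^ k i]
end

section
/- Let x ∈ ℝⁿ satisfy x₁ ≤ x₂ ≤ … ≤ xₙ. Then the convex hull of the orbit { (x_{σ(1)},…,x_{σ(n)}) : σ a permutation of {1,…,n} } equals the set of y ∈ ℝⁿ such that Σ_{i=1}^n y_i = Σ_{i=1}^n x_i and, for every subset K ⊆ {1,…,n}, Σ_{i ∈ K} y_i ≤ Σ_{i = n−|K|+1}^{n} x_i (the sum of the |K| largest coordinates of x). -/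
theorem Fin.card_filter_le_val (n m : ℕ) :
    (Finset.univ.filter (fun i : Fin n => m ≤ (i : ℕ))).card = n - m := by
  have h := Finset.card_filter_add_card_filter_not (s := (Finset.univ : Finset (Fin n)))
    (fun i : Fin n => (i : ℕ) < m)
  simp only [Fin.card_filter_val_lt, not_lt, Finset.card_univ, Fintype.card_fin] at h
  omega

/-- A sum of values of a monotone function is at most the sum of equally many largest values. -/
theorem Monotone.sum_le_sum_filter_top {n : ℕ} {x : Fin n → ℝ} (hx : Monotone x)
    (S : Finset (Fin n)) :
    ∑ i ∈ S, x i ≤ ∑ i ∈ Finset.univ.filter (fun i : Fin n => n - S.card ≤ (i : ℕ)), x i := by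
  rcases S.eq_empty_or_nonempty with rfl | hS
  · rw [Finset.filter_false_of_mem fun i _ => by simp]
  have hpos : 0 < S.card := hS.card_pos
  have hle : S.card ≤ n := by simpa using S.card_le_univ
  set T := Finset.univ.filter (fun i : Fin n => n - S.card ≤ (i : ℕ)) with hT
  have hcard : S.card = T.card := by rw [hT, Fin.card_filter_le_val]; omega
  let m : Fin n := ⟨n - S.card, by omega⟩
  have h₁ : ∑ i ∈ S \ T, x i ≤ (S \ T).card • x m := by
    refine Finset.sum_le_card_nsmul _ _ _ fun i hi => hx ?_
    simp only [hT, Finset.mem_sdiff, Finset.mem_filter, Finset.mem_univ, true_and] at hi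
    exact Fin.le_def.2 (by simp only [m]; omega)
  have h₂ : (T \ S).card • x m ≤ ∑ i ∈ T \ S, x i := by
    refine Finset.card_nsmul_le_sum _ _ _ fun i hi => hx ?_
    simp only [hT, Finset.mem_sdiff, Finset.mem_filter, Finset.mem_univ, true_and] at hi
    exact Fin.le_def.2 hi.1
  rw [Finset.card_sdiff_comm hcard] at h₁
  rw [← Finset.sum_sdiff_le_sum_sdiff]
  exact h₁.trans h₂

/-- Abel summation bound: weighting a sequence with nonnegative tail sums by a monotone sequence
bounded below by `c` gives at least `c` times its total. -/
theorem Monotone.mul_sum_le_sum_mul {n : ℕ} {d z : Fin n → ℝ} (hd : Monotone d)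
    (hz : ∀ m : ℕ, 0 ≤ ∑ i ∈ Finset.univ.filter (fun i : Fin n => m ≤ (i : ℕ)), z i)
    {c : ℝ} (hc : ∀ i, c ≤ d i) : c * ∑ i, z i ≤ ∑ i, d i * z i := by
  induction n generalizing c with
  | zero => simp
  | succ n ih =>
    have htail := ih (d := fun i => d i.succ) (z := fun i => z i.succ)
      (fun i j h => hd (Fin.succ_le_succ_iff.2 h))
      (fun m => by
        have := hz (m + 1)
        rw [Finset.sum_filter, Fin.sum_univ_succ] at this
        simpa [Finset.sum_filter] using this)
      (c := d 0) (fun i => hd (Fin.zero_le _))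
    have htotal : 0 ≤ ∑ i, z i := by simpa using hz 0
    calc c * ∑ i, z i ≤ d 0 * ∑ i, z i := mul_le_mul_of_nonneg_right (hc 0) htotal
      _ ≤ ∑ i, d i * z i := by
        rw [Fin.sum_univ_succ, Fin.sum_univ_succ (f := fun i => d i * z i), mul_add]
        exact add_le_add_right htail _

/-- A linear functional takes at `y` at most its value at some permutation of `x`, when `x`
majorizes `y`. -/
theorem exists_perm_sum_mul_le {n : ℕ} {x y : Fin n → ℝ} (hsum : ∑ i, y i = ∑ i, x i)
    (hy : ∀ K : Finset (Fin n), ∑ i ∈ K, y i ≤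
      ∑ i ∈ Finset.univ.filter (fun i : Fin n => n - K.card ≤ (i : ℕ)), x i) (c : Fin n → ℝ) :
    ∃ σ : Equiv.Perm (Fin n), ∑ i, c i * y i ≤ ∑ i, c i * x (σ i) := by
  set τ := Tuple.sort c
  have hd : Monotone (c ∘ τ) := Tuple.monotone_sort c
  refine ⟨τ.symm, ?_⟩
  obtain ⟨b, hb⟩ := (Set.finite_range (c ∘ τ)).bddBelow
  have key := hd.mul_sum_le_sum_mul (z := fun i => x i - y (τ i)) (c := b) (fun m => by
      have h := hy ((Finset.univ.filter (fun i : Fin n => m ≤ (i : ℕ))).map τ.toEmbedding)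
      rw [Finset.sum_map, Finset.card_map, Fin.card_filter_le_val] at h
      have hfilter : Finset.univ.filter (fun i : Fin n => n - (n - m) ≤ (i : ℕ)) =
          Finset.univ.filter (fun i : Fin n => m ≤ (i : ℕ)) := by
        ext i
        have := i.isLt
        simp only [Finset.mem_filter, Finset.mem_univ, true_and]
        omega
      rw [hfilter] at h
      rw [Finset.sum_sub_distrib]
      exact sub_nonneg.2 h)
    (fun i => hb ⟨i, rfl⟩)
  have htotal : ∑ i, (x i - y (τ i)) = 0 := by
    rw [Finset.sum_sub_distrib, Equiv.sum_comp τ y, hsum, sub_self]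
  rw [htotal, mul_zero] at key
  simp only [mul_sub, Finset.sum_sub_distrib, Function.comp_apply] at key
  rw [← Equiv.sum_comp τ (fun i => c i * y i), ← Equiv.sum_comp τ (fun i => c i * x (τ.symm i))]
  simpa using key


/-- For `x ∈ ℝⁿ` with nondecreasing coordinates, the convex hull of the permutation orbit of
`x` is the set of `y` with the same coordinate sum and such that the sum of the coordinates of
`y` over any subset `K` is at most the sum of the `|K|` largest coordinates of `x`. -/
theorem stmt9 {n : ℕ} (x : Fin n → ℝ) (hx : Monotone x) :
    convexHull ℝ {y : Fin n → ℝ | ∃ σ : Equiv.Perm (Fin n), y = x ∘ σ} =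
      {y : Fin n → ℝ | (∑ i, y i = ∑ i, x i) ∧
        ∀ K : Finset (Fin n), ∑ i ∈ K, y i ≤
          ∑ i ∈ Finset.univ.filter (fun i : Fin n => n - K.card ≤ (i : ℕ)), x i} := by
 
  apply Set.Subset.antisymm
  · refine convexHull_min ?_ ?_
    · rintro _ ⟨σ, rfl⟩
      refine ⟨Equiv.sum_comp σ x, fun K => ?_⟩
      simpa using hx.sum_le_sum_filter_top (K.map σ.toEmbedding)
    · rintro u ⟨hu, hu'⟩ v ⟨hv, hv'⟩ a b ha hb hab
      refine ⟨?_, fun K => ?_⟩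
      · simp only [Pi.add_apply, Pi.smul_apply, smul_eq_mul, Finset.sum_add_distrib,
          ← Finset.mul_sum, hu, hv, ← add_mul, hab, one_mul]
      · simp only [Pi.add_apply, Pi.smul_apply, smul_eq_mul, Finset.sum_add_distrib,
          ← Finset.mul_sum]
        calc a * ∑ i ∈ K, u i + b * ∑ i ∈ K, v i
            ≤ a * _ + b * _ := add_le_add (mul_le_mul_of_nonneg_left (hu' K) ha)
              (mul_le_mul_of_nonneg_left (hv' K) hb)
          _ = _ := by rw [← add_mul, hab, one_mul]
  · rintro y ⟨hsum, hy⟩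
    by_contra hmem
    have hfin : {y : Fin n → ℝ | ∃ σ : Equiv.Perm (Fin n), y = x ∘ σ}.Finite :=
      (Set.finite_range fun σ : Equiv.Perm (Fin n) => x ∘ σ).subset
        (by rintro _ ⟨σ, rfl⟩; exact ⟨σ, rfl⟩)
    obtain ⟨f, u, hfu, huy⟩ := geometric_hahn_banach_closed_point (convex_convexHull ℝ _)
      (hfin.isClosed_convexHull ℝ) hmem
    have hf (v : Fin n → ℝ) : f v = ∑ i, f (Pi.single i 1) * v i := by
      rw [← ContinuousLinearMap.coe_coe, LinearMap.pi_apply_eq_sum_univ]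
      refine Finset.sum_congr rfl fun i _ => ?_
      rw [smul_eq_mul, mul_comm]
      congr 2
      ext j
      simp [Pi.single_apply, eq_comm]
    obtain ⟨σ, hσ⟩ := exists_perm_sum_mul_le hsum hy fun i => f (Pi.single i 1)
    have hlt := hfu (x ∘ σ) (subset_convexHull ℝ _ ⟨σ, rfl⟩)
    rw [hf] at hlt huy
    exact (hlt.trans huy).not_ge hσ
end

section
/- Let x, y ∈ ℝⁿ both have nondecreasing coordinates (x₁ ≤ … ≤ xₙ and y₁ ≤ … ≤ yₙ). Then C(x + y) = C(x) + C(y), where the right-hand side is the Minkowski sum; that is, the convex hull of the permutation orbit of x + y equals the Minkowski sum of the convex hulls of the permutation orbits of x and of y. -/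
open Pointwise

/-- The convex hull of the set of vectors obtained from `x` by permuting its coordinates. -/
def permHull {n : ℕ} (x : Fin n → ℝ) : Set (Fin n → ℝ) :=
  convexHull ℝ {y : Fin n → ℝ | ∃ σ : Equiv.Perm (Fin n), y = x ∘ σ}

theorem comp_perm_mem_permHull {n : ℕ} (x : Fin n → ℝ) (σ : Equiv.Perm (Fin n)) :
    x ∘ σ ∈ permHull x :=
  subset_convexHull ℝ _ ⟨σ, rfl⟩

theorem isClosed_permHull {n : ℕ} (x : Fin n → ℝ) : IsClosed (permHull x) := by
  have hfin : {y : Fin n → ℝ | ∃ σ : Equiv.Perm (Fin n), y = x ∘ σ}.Finite :=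
    (Set.finite_range fun σ : Equiv.Perm (Fin n) => x ∘ σ).subset
      fun y ⟨σ, hσ⟩ => ⟨σ, hσ.symm⟩
  exact hfin.isClosed_convexHull ℝ

/-- The rearrangement inequality: if `π` sorts `c`, then among the rearrangements of a monotone
`x`, the one by `π⁻¹` maximises the linear functional with coefficients `c`. -/
theorem sum_mul_comp_perm_le_of_monotone {n : ℕ} {c x : Fin n → ℝ} {π : Equiv.Perm (Fin n)}
    (hc : Monotone (c ∘ π)) (hx : Monotone x) (σ : Equiv.Perm (Fin n)) :
    ∑ i, c i * x (σ i) ≤ ∑ i, c i * x (π⁻¹ i) := by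
  have h := (hc.monovary hx).sum_mul_comp_perm_le_sum_mul (σ := σ * π)
  rw [← Equiv.sum_comp π fun i => c i * x (σ i), ← Equiv.sum_comp π fun i => c i * x (π⁻¹ i)]
  simpa using h

theorem comp_perm_add_comp_perm_mem_permHull {n : ℕ} {x y : Fin n → ℝ} (hx : Monotone x)
    (hy : Monotone y) (σ τ : Equiv.Perm (Fin n)) : x ∘ σ + y ∘ τ ∈ permHull (x + y) := by
  by_contra hmem
  obtain ⟨f, u, hlt, hgt⟩ :=
    geometric_hahn_banach_closed_point (convex_convexHull ℝ _) (isClosed_permHull (x + y)) hmem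
  set c : Fin n → ℝ := fun i => f (Pi.single i 1) with hc
  have hf (v : Fin n → ℝ) : f v = ∑ i, c i * v i := by
    conv_lhs => rw [pi_eq_sum_univ' v]
    simp [hc, mul_comm]
  have hπ : Monotone (c ∘ Tuple.sort c) := Tuple.monotone_sort c
  have h := hlt _ (comp_perm_mem_permHull (x + y) (Tuple.sort c)⁻¹)
  have hσ := sum_mul_comp_perm_le_of_monotone hπ hx σ
  have hτ := sum_mul_comp_perm_le_of_monotone hπ hy τ
  simp only [hf, Pi.add_apply, Function.comp_apply, mul_add, Finset.sum_add_distrib] at h hgt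
  linarith

/-- For `x, y ∈ ℝⁿ` with nondecreasing coordinates, the convex hull of the permutation orbit
of `x + y` is the Minkowski sum of the convex hulls of the permutation orbits of `x` and `y`. -/
theorem stmt10 {n : ℕ} (x y : Fin n → ℝ) (hx : Monotone x) (hy : Monotone y) :
    permHull (x + y) = permHull x + permHull y := by
  apply Set.Subset.antisymm
  · refine convexHull_min ?_ ((convex_convexHull ℝ _).add (convex_convexHull ℝ _))
    rintro _ ⟨σ, rfl⟩
    exact Set.add_mem_add (comp_perm_mem_permHull x σ) (comp_perm_mem_permHull y σ)
  · rw [permHull.eq_def x, permHull.eq_def y, ← convexHull_add]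
    refine convexHull_min ?_ (convex_convexHull ℝ _)
    rintro _ ⟨_, ⟨σ, rfl⟩, _, ⟨τ, rfl⟩, rfl⟩
    exact comp_perm_add_comp_perm_mem_permHull hx hy σ τ
end

section
/- Let P be a nonzero multivariate polynomial in the n² variables x_{ij}, 1 ≤ i,j ≤ n, with complex coefficients. Then the set { U ∈ U(n) : P evaluated at the entries of U equals 0 } has measure zero with respect to the Haar probability measure on the unitary group U(n). -/
open Matrix MeasureTheory

open Filter Topology in
/-- The proportion of zeros of a nonzero polynomial in the grid `{0, …, N - 1}ᵐ` tends to `0`. -/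
theorem MvPolynomial.tendsto_card_zeros_div_card_grid {m : ℕ} {p : MvPolynomial (Fin m) ℂ}
    (hp : p ≠ 0) :
    Tendsto (fun N : ℕ =>
      (((Fintype.piFinset fun _ : Fin m => Finset.range N).filter fun y =>
        MvPolynomial.eval (fun i => (y i : ℂ)) p = 0).card : ENNReal) / ((N ^ m : ℕ) : ENNReal))
      atTop (𝓝 0) := by
  have hbound : ∀ N : ℕ, 0 < N →
      (((Fintype.piFinset fun _ : Fin m => Finset.range N).filter fun y =>
        MvPolynomial.eval (fun i => (y i : ℂ)) p = 0).card : ENNReal) / ((N ^ m : ℕ) : ENNReal)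
        ≤ (p.totalDegree : ENNReal) * (N : ENNReal)⁻¹ := by
    intro N hN
    have hsz := MvPolynomial.schwartz_zippel_totalDegree hp
      ((Finset.range N).map (Nat.castEmbedding (R := ℂ)))
    rw [Finset.card_map, Finset.card_range] at hsz
    have hcard : ((Fintype.piFinset fun _ : Fin m => Finset.range N).filter fun y =>
        MvPolynomial.eval (fun i => (y i : ℂ)) p = 0).card ≤
        ((Fintype.piFinset fun _ : Fin m =>
          (Finset.range N).map (Nat.castEmbedding (R := ℂ))).filter fun f =>
          MvPolynomial.eval f p = 0).card := by
      refine Finset.card_le_card_of_injOn (fun y i => (y i : ℂ)) ?_ ?_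
      · intro y hy
        simp only [Finset.coe_filter, Fintype.mem_piFinset, Finset.mem_range,
          Set.mem_ofPred_eq] at hy
        simp only [Finset.coe_filter, Fintype.mem_piFinset, Finset.mem_map, Finset.mem_range,
          Set.mem_ofPred_eq]
        exact ⟨fun i => ⟨y i, hy.1 i, rfl⟩, hy.2⟩
      · intro y _ z _ hyz
        ext i
        exact Nat.cast_injective (R := ℂ) (congrFun hyz i)
    have hN' : (0 : ℚ≥0) < N := by exact_mod_cast hN
    rw [div_le_div_iff₀ (by positivity) hN'] at hsz
    have hnat : ((Fintype.piFinset fun _ : Fin m => Finset.range N).filter fun y =>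
        MvPolynomial.eval (fun i => (y i : ℂ)) p = 0).card * N ≤ p.totalDegree * N ^ m :=
      (Nat.mul_le_mul_right N hcard).trans (by exact_mod_cast hsz)
    have hN0 : (N : ENNReal) ≠ 0 := by exact_mod_cast hN.ne'
    have hNm : ((N ^ m : ℕ) : ENNReal) ≠ 0 := by exact_mod_cast (pow_pos hN m).ne'
    rw [← div_eq_mul_inv, ENNReal.div_le_iff hNm (ENNReal.natCast_ne_top _),
      ← ENNReal.mul_div_right_comm,
      ENNReal.le_div_iff_mul_le (Or.inl hN0) (Or.inl (ENNReal.natCast_ne_top _))]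
    exact_mod_cast hnat
  have hlim : Tendsto (fun N : ℕ => (p.totalDegree : ENNReal) * (N : ENNReal)⁻¹) atTop (𝓝 0) := by
    simpa using ENNReal.Tendsto.const_mul ENNReal.tendsto_inv_nat_nhds_zero
      (Or.inr (ENNReal.natCast_ne_top p.totalDegree))
  exact tendsto_of_tendsto_of_tendsto_of_le_of_le' tendsto_const_nhds hlim
    (Eventually.of_forall fun _ => zero_le) (eventually_atTop.2 ⟨1, fun N hN => hbound N hN⟩)

open Filter Topology in
/-- If sets `V y`, indexed by grid points `y`, all have measure `c`, and for each `x` the indices `y`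
with `x ∈ V y` are zeros of a nonzero polynomial depending on `x`, then `c = 0`. -/
theorem measure_eq_zero_of_forall_mem_imp_eval_eq_zero {X : Type*} [MeasurableSpace X]
    (μ : Measure X) [IsProbabilityMeasure μ] {m : ℕ} (V : (Fin m → ℕ) → Set X)
    (hV : ∀ y, MeasurableSet (V y)) (c : ENNReal) (hc : ∀ y, μ (V y) = c)
    (p : X → MvPolynomial (Fin m) ℂ) (hp : ∀ x, p x ≠ 0)
    (h : ∀ x y, x ∈ V y → MvPolynomial.eval (fun i => (y i : ℂ)) (p x) = 0) : c = 0 := by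
  classical
  let G : ℕ → Finset (Fin m → ℕ) := fun N => Fintype.piFinset fun _ => Finset.range N
  have hG : ∀ N, (G N).card = N ^ m := fun N => by simp [G]
  let F : ℕ → X → ENNReal := fun N x =>
    (∑ y ∈ G N, (V y).indicator 1 x) / ((N ^ m : ℕ) : ENNReal)
  have hsum : ∀ N x, (∑ y ∈ G N, (V y).indicator (1 : X → ENNReal) x) =
      (((G N).filter fun y => x ∈ V y).card : ENNReal) := fun N x => by
    simp [Set.indicator_apply, Finset.sum_boole]
  have hFm : ∀ N, Measurable (F N) := fun N =>
    (Finset.measurable_fun_sum _ fun y _ => measurable_one.indicator (hV y)).div_const _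
  have hF1 : ∀ N, F N ≤ᵐ[μ] fun _ => 1 := fun N => Eventually.of_forall fun x => by
    simp only [F, hsum]
    refine ENNReal.div_le_of_le_mul ?_
    rw [one_mul, ← hG]
    exact_mod_cast Finset.card_filter_le _ _
  have hF0 : ∀ x, Tendsto (fun N => F N x) atTop (𝓝 0) := fun x => by
    refine tendsto_of_tendsto_of_tendsto_of_le_of_le tendsto_const_nhds
      (MvPolynomial.tendsto_card_zeros_div_card_grid (hp x)) (fun _ => zero_le) fun N => ?_
    simp only [F, hsum]
    refine ENNReal.div_le_div_right ?_ _
    exact_mod_cast Finset.card_le_card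
      (Finset.monotone_filter_right _ fun y _ hy => h x y hy)
  have hint : ∀ N, 0 < N → ∫⁻ x, F N x ∂μ = c := fun N hN => by
    have hNm : ((N ^ m : ℕ) : ENNReal) ≠ 0 := by exact_mod_cast (pow_pos hN m).ne'
    simp only [F, div_eq_mul_inv]
    rw [lintegral_mul_const _
      (Finset.measurable_fun_sum _ fun y _ => measurable_one.indicator (hV y)),
      lintegral_finsetSum _ fun y _ => measurable_one.indicator (hV y)]
    simp only [lintegral_indicator_one (hV _), hc, Finset.sum_const, hG, nsmul_eq_mul]
    rw [mul_comm, ← mul_assoc, ENNReal.inv_mul_cancel hNm (ENNReal.natCast_ne_top _), one_mul]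
  have hlim := tendsto_lintegral_of_dominated_convergence (μ := μ) (fun _ => 1) hFm hF1 (by simp)
    (Eventually.of_forall hF0)
  rw [lintegral_zero] at hlim
  exact tendsto_nhds_unique (tendsto_const_nhds.congr'
    (eventually_atTop.2 ⟨1, fun N hN => (hint N hN).symm⟩)) hlim

/-- The Cayley transform `(1 - S)(1 + S)⁻¹` of a square matrix. -/
noncomputable def Matrix.cayley {n : Type*} [Fintype n] [DecidableEq n]
    (S : Matrix n n ℂ) : Matrix n n ℂ :=
  (1 - S) * (1 + S)⁻¹

section Cayley

variable {n : Type*} [Fintype n] [DecidableEq n]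

open scoped ComplexOrder in
theorem Matrix.isUnit_det_one_add_of_conjTranspose_eq_neg {S : Matrix n n ℂ} (hS : Sᴴ = -S) :
    IsUnit (1 + S).det := by
  have hpos : (1 + Sᴴ * S).PosDef :=
    Matrix.PosDef.one.add_posSemidef (Matrix.posSemidef_conjTranspose_mul_self S)
  have hmul : (1 - S) * (1 + S) = 1 + Sᴴ * S := by rw [hS]; noncomm_ring
  have hu := (Matrix.isUnit_iff_isUnit_det _).1 hpos.isUnit
  rw [← hmul, Matrix.det_mul] at hu
  exact isUnit_of_mul_isUnit_right hu

theorem Matrix.cayley_mem_unitaryGroup {S : Matrix n n ℂ} (hS : Sᴴ = -S) :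
    S.cayley ∈ Matrix.unitaryGroup n ℂ := by
  have h1 := isUnit_det_one_add_of_conjTranspose_eq_neg hS
  have h2 : IsUnit (1 - S).det := by
    have := isUnit_det_one_add_of_conjTranspose_eq_neg (S := -S) (by rw [conjTranspose_neg, hS])
    rwa [← sub_eq_add_neg] at this
  rw [Matrix.mem_unitaryGroup_iff', star_eq_conjTranspose, cayley, conjTranspose_mul,
    conjTranspose_nonsing_inv, conjTranspose_add, conjTranspose_sub, conjTranspose_one, hS,
    sub_neg_eq_add, ← sub_eq_add_neg]
  calc (1 - S)⁻¹ * (1 + S) * ((1 - S) * (1 + S)⁻¹)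
      = (1 - S)⁻¹ * ((1 + S) * (1 - S)) * (1 + S)⁻¹ := by simp only [Matrix.mul_assoc]
    _ = (1 - S)⁻¹ * ((1 - S) * (1 + S)) * (1 + S)⁻¹ := by
        congr 2; noncomm_ring
    _ = 1 := by
        rw [← Matrix.mul_assoc, Matrix.nonsing_inv_mul _ h2, Matrix.one_mul,
          Matrix.mul_nonsing_inv _ h1]

/-- Every matrix `W` with `1 + W` invertible is a Cayley transform. -/
theorem Matrix.exists_cayley_eq {W : Matrix n n ℂ} (hW : IsUnit (1 + W).det) :
    ∃ S : Matrix n n ℂ, IsUnit (1 + S).det ∧ S.cayley = W := by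
  have hS : 1 + (1 - W) * (1 + W)⁻¹ = (2 : ℂ) • (1 + W)⁻¹ := by
    calc 1 + (1 - W) * (1 + W)⁻¹ = ((1 + W) + (1 - W)) * (1 + W)⁻¹ := by
          rw [Matrix.add_mul (1 + W), Matrix.mul_nonsing_inv _ hW]
      _ = (2 : ℂ) • (1 + W)⁻¹ := by
          rw [← Matrix.one_mul ((2 : ℂ) • (1 + W)⁻¹), Matrix.mul_smul, ← Matrix.smul_mul]
          congr 1
          rw [two_smul]; abel
  have hS' : 1 - (1 - W) * (1 + W)⁻¹ = (2 : ℂ) • (W * (1 + W)⁻¹) := by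
    calc 1 - (1 - W) * (1 + W)⁻¹ = ((1 + W) - (1 - W)) * (1 + W)⁻¹ := by
          rw [Matrix.sub_mul (1 + W), Matrix.mul_nonsing_inv _ hW]
      _ = (2 : ℂ) • (W * (1 + W)⁻¹) := by
          rw [← Matrix.smul_mul]
          congr 1
          rw [two_smul]; abel
  have hinv : (1 + (1 - W) * (1 + W)⁻¹)⁻¹ = (2 : ℂ)⁻¹ • (1 + W) := by
    refine Matrix.inv_eq_right_inv ?_
    rw [hS, Matrix.smul_mul, Matrix.mul_smul, Matrix.nonsing_inv_mul _ hW, smul_smul]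
    norm_num
  refine ⟨(1 - W) * (1 + W)⁻¹, ?_, ?_⟩
  · rw [hS, Matrix.det_smul]
    exact ((isUnit_iff_ne_zero.2 two_ne_zero).pow _).mul (Matrix.isUnit_nonsing_inv_det _ hW)
  · rw [cayley, hinv, hS', Matrix.smul_mul, Matrix.mul_smul, Matrix.mul_assoc,
      Matrix.nonsing_inv_mul _ hW, smul_smul, Matrix.mul_one]
    norm_num

/-- The generic matrix `(1 + i) Y + (i - 1) Yᵀ`, which is skew-Hermitian for real `Y`. -/
noncomputable def genericSkew (n : Type*) : Matrix n n (MvPolynomial (n × n) ℂ) :=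
  Matrix.of fun i j => MvPolynomial.C (1 + Complex.I) * MvPolynomial.X (i, j) +
    MvPolynomial.C (Complex.I - 1) * MvPolynomial.X (j, i)

/-- The matrix `(1 + i) Y + (i - 1) Yᵀ`. -/
noncomputable def skewOf (Y : n × n → ℂ) : Matrix n n ℂ :=
  (MvPolynomial.eval Y).mapMatrix (genericSkew n)

theorem skewOf_apply (Y : n × n → ℂ) (i j : n) :
    skewOf Y i j = (1 + Complex.I) * Y (i, j) + (Complex.I - 1) * Y (j, i) := by
  simp [skewOf, genericSkew]

theorem conjTranspose_skewOf_natCast (y : n × n → ℕ) :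
    (skewOf fun q => (y q : ℂ))ᴴ = -skewOf fun q => (y q : ℂ) := by
  ext i j
  simp only [conjTranspose_apply, Matrix.neg_apply, skewOf_apply, star_add, star_mul', star_sub, star_one,
    star_natCast, RCLike.star_def, Complex.conj_I]
  ring

theorem skewOf_surjective : Function.Surjective (skewOf : (n × n → ℂ) → Matrix n n ℂ) := by
  intro S
  refine ⟨fun q => (4 : ℂ)⁻¹ * ((1 - Complex.I) * S q.1 q.2 - (1 + Complex.I) * S q.2 q.1), ?_⟩
  ext i j
  rw [skewOf_apply]
  ring_nf
  simp only [Complex.I_sq]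
  ring

/-- Clearing denominators in a polynomial of the entries of `A(Y) U`, with `A` the
Cayley transform. -/
theorem exists_eval_eq_det_pow_mul_eval_cayley_mul (U : Matrix n n ℂ)
    (P : MvPolynomial (n × n) ℂ) :
    ∃ (d : ℕ) (N : MvPolynomial (n × n) ℂ), ∀ Y : n × n → ℂ, IsUnit (1 + skewOf Y).det →
      MvPolynomial.eval Y N = (1 + skewOf Y).det ^ d *
        MvPolynomial.eval (fun q => ((skewOf Y).cayley * U) q.1 q.2) P := by
  let D : MvPolynomial (n × n) ℂ := (1 + genericSkew n).det
  have hD : ∀ Y, MvPolynomial.eval Y D = (1 + skewOf Y).det := fun Y => by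
    simp only [D, RingHom.map_det, map_add, map_one, skewOf]
  let E : Matrix n n (MvPolynomial (n × n) ℂ) :=
    (1 - genericSkew n) * (1 + genericSkew n).adjugate * MvPolynomial.C.mapMatrix U
  have hE : ∀ (Y : n × n → ℂ) (i j : n), IsUnit (1 + skewOf Y).det →
      MvPolynomial.eval Y (E i j) =
        (1 + skewOf Y).det * ((skewOf Y).cayley * U) i j := fun Y i j hY => by
    have hU : (MvPolynomial.eval Y).mapMatrix (MvPolynomial.C.mapMatrix U) = U := by
      ext; simp
    have hmap : (MvPolynomial.eval Y).mapMatrix E =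
        (1 - skewOf Y) * (1 + skewOf Y).adjugate * U := by
      simp only [E, map_mul, map_sub, map_one, RingHom.map_adjugate, map_add, hU, skewOf]
    have hadj : (1 + skewOf Y).adjugate = (1 + skewOf Y).det • (1 + skewOf Y)⁻¹ := by
      rw [Matrix.inv_def, smul_smul, Ring.mul_inverse_cancel _ hY, one_smul]
    rw [hadj, Matrix.mul_smul, Matrix.smul_mul] at hmap
    exact congrFun (congrFun hmap i) j
  induction P using MvPolynomial.induction_on with
  | C a => exact ⟨0, MvPolynomial.C a, fun Y _ => by simp⟩
  | add p q hp hq =>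
    obtain ⟨d, N, hN⟩ := hp
    obtain ⟨e, M, hM⟩ := hq
    refine ⟨d + e, N * D ^ e + M * D ^ d, fun Y hY => ?_⟩
    simp only [map_add, map_mul, map_pow, hN Y hY, hM Y hY, hD]
    ring
  | mul_X p q hp =>
    obtain ⟨d, N, hN⟩ := hp
    refine ⟨d + 1, N * E q.1 q.2, fun Y hY => ?_⟩
    simp only [map_mul, hN Y hY, hE Y _ _ hY, MvPolynomial.eval_X]
    ring

/-- A polynomial vanishing at all `A U`, with `U` a fixed invertible matrix and `A` ranging over
the Cayley transforms, is zero. -/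
theorem eq_zero_of_forall_eval_cayley_mul_eq_zero {U : Matrix n n ℂ} (hU : IsUnit U.det)
    {P : MvPolynomial (n × n) ℂ}
    (h : ∀ Y : n × n → ℂ, IsUnit (1 + skewOf Y).det →
      MvPolynomial.eval (fun q => ((skewOf Y).cayley * U) q.1 q.2) P = 0) : P = 0 := by
  let R : MvPolynomial (n × n) ℂ :=
    (1 + Matrix.of (fun i j => MvPolynomial.X (i, j)) * MvPolynomial.C.mapMatrix U⁻¹).det
  have hR : ∀ Z : n × n → ℂ, MvPolynomial.eval Z R =
      (1 + Matrix.of (fun i j => Z (i, j)) * U⁻¹).det := fun Z => by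
    have h1 : (MvPolynomial.eval Z).mapMatrix (MvPolynomial.C.mapMatrix U⁻¹) = U⁻¹ := by
      ext; simp
    have h2 : (MvPolynomial.eval Z).mapMatrix (Matrix.of (fun i j => MvPolynomial.X (i, j))) =
        Matrix.of (fun i j => Z (i, j)) := by
      ext; simp
    simp only [R, RingHom.map_det, map_add, map_one, map_mul, h1, h2]
  have hR0 : R ≠ 0 := fun h0 => by
    have := hR 0
    have hz : (Matrix.of fun i j : n => (0 : n × n → ℂ) (i, j)) = 0 := rfl
    rw [h0, map_zero, hz, Matrix.zero_mul, add_zero, Matrix.det_one] at this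
    exact zero_ne_one this
  have hRP : R * P = 0 := by
    refine MvPolynomial.funext fun Z => ?_
    rw [map_mul, map_zero, mul_eq_zero, or_iff_not_imp_left, hR]
    intro hZ
    obtain ⟨S, hS, hSW⟩ := Matrix.exists_cayley_eq (isUnit_iff_ne_zero.2 hZ)
    obtain ⟨Y, rfl⟩ := skewOf_surjective S
    have := h Y hS
    rwa [hSW, Matrix.mul_assoc, Matrix.nonsing_inv_mul _ hU, Matrix.mul_one] at this
  exact (mul_eq_zero.1 hRP).resolve_left hR0

end Cayley

/-- The set of unitary zeros of a nonzero polynomial in the `n²` matrix entries has measure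
zero with respect to the Haar probability measure on the unitary group `U(n)`. -/
theorem stmt13 {n : ℕ} [MeasurableSpace (Matrix.unitaryGroup (Fin n) ℂ)]
    [BorelSpace (Matrix.unitaryGroup (Fin n) ℂ)]
    (μ : Measure (Matrix.unitaryGroup (Fin n) ℂ))
    [μ.IsHaarMeasure] [IsProbabilityMeasure μ]
    (P : MvPolynomial (Fin n × Fin n) ℂ) (hP : P ≠ 0) :
    μ {U : Matrix.unitaryGroup (Fin n) ℂ |
      MvPolynomial.eval (fun q => (U : Matrix (Fin n) (Fin n) ℂ) q.1 q.2) P = 0} = 0 := by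
  set Z : Set (Matrix.unitaryGroup (Fin n) ℂ) := {U |
    MvPolynomial.eval (fun q => (U : Matrix (Fin n) (Fin n) ℂ) q.1 q.2) P = 0} with hZ
  have hZm : MeasurableSet Z := by
    refine IsClosed.measurableSet (isClosed_eq ?_ continuous_const)
    refine (MvPolynomial.continuous_eval P).comp (continuous_pi fun q => ?_)
    exact continuous_subtype_val.matrix_elem q.1 q.2
  choose d N hN using fun U : Matrix.unitaryGroup (Fin n) ℂ =>
    exists_eval_eq_det_pow_mul_eval_cayley_mul (U : Matrix (Fin n) (Fin n) ℂ) P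
  have hN0 : ∀ U, N U ≠ 0 := fun U h0 => hP <| by
    refine eq_zero_of_forall_eval_cayley_mul_eq_zero
      (Matrix.UnitaryGroup.det_isUnit U) fun Y hY => ?_
    have := hN U Y hY
    rw [h0, map_zero, eq_comm, mul_eq_zero] at this
    exact this.resolve_left (hY.pow _).ne_zero
  let e : Fin n × Fin n ≃ Fin (n * n) := finProdFinEquiv
  let g : (Fin (n * n) → ℕ) → Matrix.unitaryGroup (Fin n) ℂ := fun y =>
    ⟨(skewOf fun q => ((y (e q) : ℕ) : ℂ)).cayley,
      Matrix.cayley_mem_unitaryGroup (conjTranspose_skewOf_natCast fun q => y (e q))⟩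
  refine measure_eq_zero_of_forall_mem_imp_eval_eq_zero μ (fun y => (fun U => g y * U) ⁻¹' Z)
    (fun y => measurable_const_mul (g y) hZm) (μ Z) (fun y => measure_preimage_mul μ (g y) Z)
    (fun U => MvPolynomial.rename e (N U)) (fun U => ?_) fun U y hU => ?_
  · exact (map_ne_zero_iff _ (MvPolynomial.rename_injective _ e.injective)).2 (hN0 U)
  · rw [MvPolynomial.eval_rename]
    refine (hN U _ (Matrix.isUnit_det_one_add_of_conjTranspose_eq_neg
      (conjTranspose_skewOf_natCast fun q => y (e q)))).trans ?_
    exact mul_eq_zero_of_right _ hU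
end

section
/- Let h : Mat_n(ℂ) → ℂ be a polynomial function (the evaluation of a multivariate polynomial in the n² matrix entries) and let m ∈ ℕⁿ be such that h(A·diag(λ)) = (∏_{i=1}^n λ_i^{m_i})·h(A) for every A ∈ Mat_n(ℂ) and every λ ∈ ℂⁿ. If h(U) ≠ 0 for every unitary matrix U ∈ U(n), then m₁ = m₂ = … = mₙ. -/
open Matrix

/-- A continuous function on a preconnected space whose exponential is constant is constant. -/
lemma Continuous.eq_of_exp_eq {X : Type*} [TopologicalSpace X] [PreconnectedSpace X] {f : X → ℂ}
    (hf : Continuous f) (hexp : ∀ x y, Complex.exp (f x) = Complex.exp (f y)) (x y : X) :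
    f x = f y :=
  congrFun (Complex.isCoveringMap_exp.eq_of_comp_eq hf (continuous_const (y := f y))
    (funext fun z => Subtype.ext (hexp z y)) y rfl) x

/-- The winding number of a free homotopy of loops in `ℂ \ {0}` is constant, for a homotopy
between multiples of `exp (i a t)` and `exp (i b t)`. -/
lemma winding_eq_of_homotopy {F : ℝ × ℝ → ℂ} (hF : Continuous F) (hF0 : ∀ x, F x ≠ 0)
    (hper : ∀ s, F (s, 2 * Real.pi) = F (s, 0)) {s₀ s₁ : ℝ} {a b : ℕ} {c d : ℂ}
    (h₀ : ∀ t : ℝ, F (s₀, t) = Complex.exp (t * Complex.I) ^ a * c)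
    (h₁ : ∀ t : ℝ, F (s₁, t) = Complex.exp (t * Complex.I) ^ b * d) : a = b := by
  obtain ⟨L, ⟨-, hL⟩, -⟩ := Complex.isCoveringMapOn_exp.existsUnique_continuousMap_lifts
    ⟨F, hF⟩ (a₀ := 0) (e₀ := Complex.log (F 0)) (Complex.exp_log (hF0 0)) hF0
  have hL' : ∀ x, Complex.exp (L x) = F x := fun x => congrFun hL x
  have increment : ∀ (s : ℝ) (k : ℕ) (c : ℂ),
      (∀ t : ℝ, F (s, t) = Complex.exp (t * Complex.I) ^ k * c) →
      L (s, 2 * Real.pi) - L (s, 0) = k * (2 * Real.pi * Complex.I) := by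
    intro s k c hk
    have key := Continuous.eq_of_exp_eq
      (f := fun t : ℝ => L (s, t) - k * (t * Complex.I)) (by fun_prop) (fun x y => by
        have : ∀ t : ℝ, Complex.exp (L (s, t) - k * (t * Complex.I)) = c := fun t => by
          rw [Complex.exp_sub, hL', hk, Complex.exp_nat_mul,
            mul_div_cancel_left₀ _ (pow_ne_zero _ (Complex.exp_ne_zero _))]
        rw [this, this]) (2 * Real.pi) 0
    push_cast at key
    linear_combination key
  have hconst := Continuous.eq_of_exp_eq
    (f := fun s : ℝ => L (s, 2 * Real.pi) - L (s, 0)) (by fun_prop) (fun x y => by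
      have : ∀ s : ℝ, Complex.exp (L (s, 2 * Real.pi) - L (s, 0)) = 1 := fun s => by
        rw [Complex.exp_sub, hL', hL', hper, div_self (hF0 _)]
      rw [this, this]) s₀ s₁
  rw [increment s₀ a c h₀, increment s₁ b d h₁] at hconst
  exact_mod_cast mul_right_cancel₀ Complex.two_pi_I_ne_zero hconst

/-- The unitary combinations of `1` and an involutive unitary matrix `Q`, with eigenvalues `1`
and `z`. -/
lemma smul_one_add_smul_mem_unitaryGroup {n : Type*} [Fintype n] [DecidableEq n]
    {Q : Matrix n n ℂ} (hQ : star Q = Q) (hQQ : Q * Q = 1) {z : ℂ} (hz : z * star z = 1) :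
    ((1 + z) / 2) • (1 : Matrix n n ℂ) + ((1 - z) / 2) • Q ∈ unitaryGroup n ℂ := by
  have e : ∀ a b a' b' : ℂ, (a • (1 : Matrix n n ℂ) + b • Q) * (a' • 1 + b' • Q)
      = (a * a' + b * b') • 1 + (a * b' + b * a') • Q := by
    intro a b a' b'
    simp only [mul_add, add_mul, smul_mul_smul_comm, mul_one, one_mul, hQQ]
    module
  rw [mem_unitaryGroup_iff, star_add, star_smul, star_smul, star_one, hQ, e]
  have h2 : star (2 : ℂ) = 2 := by simp
  simp only [star_div₀, star_add, star_sub, star_one, h2]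
  rw [show (1 + z) / 2 * ((1 + star z) / 2) + (1 - z) / 2 * ((1 - star z) / 2) = 1 by
      linear_combination hz / 2,
    show (1 + z) / 2 * ((1 - star z) / 2) + (1 - z) / 2 * ((1 + star z) / 2) = 0 by
      linear_combination -hz / 2]
  simp

lemma Complex.exp_ofReal_mul_I_mul_star (t : ℝ) :
    Complex.exp (t * Complex.I) * star (Complex.exp (t * Complex.I)) = 1 := by
  rw [Complex.star_def, Complex.mul_conj, Complex.normSq_eq_norm_sq,
    Complex.norm_exp_ofReal_mul_I]
  simp

lemma diagonal_update_mem_unitaryGroup {n : Type*} [Fintype n] [DecidableEq n] (i : n) {z : ℂ}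
    (hz : z * star z = 1) : diagonal (Function.update 1 i z) ∈ unitaryGroup n ℂ := by
  rw [mem_unitaryGroup_iff, star_eq_conjTranspose, diagonal_conjTranspose, diagonal_mul_diagonal,
    ← diagonal_one]
  congr 1
  funext k
  rcases eq_or_ne k i with rfl | hk
  · simpa using hz
  · simp [hk]

lemma diagonal_update_mul_swap {n : Type*} [Fintype n] [DecidableEq n] (i j : n) (z : ℂ) :
    diagonal (Function.update 1 i z) * (Equiv.swap i j).permMatrix ℂ
      = (Equiv.swap i j).permMatrix ℂ * diagonal (Function.update 1 j z) := by
  ext k l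
  rw [diagonal_mul, mul_diagonal, Equiv.Perm.permMatrix, PEquiv.toMatrix_apply]
  by_cases hl : Equiv.swap i j k = l
  · subst hl
    have : Equiv.swap i j k = j ↔ k = i := by
      rw [Equiv.swap_apply_eq_iff, Equiv.swap_apply_right]
    simp [Function.update_apply, this]
  · simp [hl]

/-- If a polynomial function `h` on `Mat_n(ℂ)` is homogeneous in the columns with multidegree
`m ∈ ℕⁿ`, i.e. `h (A · diag λ) = (∏ i, λ i ^ m i) · h A`, and `h` does not vanish on the
unitary group `U(n)`, then all the `m i` are equal. -/
theorem stmt16 {n : ℕ} (h : Matrix (Fin n) (Fin n) ℂ → ℂ)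
    (P : MvPolynomial (Fin n × Fin n) ℂ)
    (hP : ∀ A, h A = MvPolynomial.eval (fun q => A q.1 q.2) P)
    (m : Fin n → ℕ)
    (hom : ∀ (A : Matrix (Fin n) (Fin n) ℂ) (l : Fin n → ℂ),
      h (A * Matrix.diagonal l) = (∏ i, l i ^ m i) * h A)
    (hvan : ∀ U ∈ Matrix.unitaryGroup (Fin n) ℂ, h U ≠ 0) :
    ∀ i j, m i = m j := by
  intro i j
  have hcont : Continuous h := by
    rw [funext hP]
    exact (MvPolynomial.continuous_eval P).comp (by fun_prop)
  have hom' : ∀ (A : Matrix (Fin n) (Fin n) ℂ) (k : Fin n) (z : ℂ),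
      h (A * diagonal (Function.update 1 k z)) = z ^ m k * h A := by
    intro A k z
    rw [hom, Finset.prod_eq_single k (fun b _ hb => by simp [hb]) (by simp)]
    simp
  set Q : Matrix (Fin n) (Fin n) ℂ := (Equiv.swap i j).permMatrix ℂ with hQdef
  have hQ : star Q = Q := by
    rw [star_eq_conjTranspose, hQdef, conjTranspose_permMatrix, Equiv.swap_inv]
  have hQQ : Q * Q = 1 := by
    rw [hQdef, ← permMatrix_mul, Equiv.swap_mul_self, permMatrix_one]
  let R : ℝ → Matrix (Fin n) (Fin n) ℂ := fun s =>
    ((1 + Complex.exp (s * Complex.I)) / 2) • 1 + ((1 - Complex.exp (s * Complex.I)) / 2) • Q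
  let D : ℝ → Matrix (Fin n) (Fin n) ℂ := fun t =>
    diagonal (Function.update 1 i (Complex.exp (t * Complex.I)))
  have hR0 : R 0 = 1 := by simp [R]
  have hRpi : R Real.pi = Q := by
    simp only [R, Complex.exp_pi_mul_I]
    norm_num
  have hD : Continuous D :=
    (continuous_const.update i (by fun_prop)).matrix_diagonal
  refine winding_eq_of_homotopy (F := fun x => h (D x.2 * R x.1)) (s₀ := 0) (s₁ := Real.pi)
    (c := h 1) (d := h Q) (by fun_prop) (fun x => hvan _ (mul_mem ?_ ?_)) (fun s => ?_)
    (fun t => ?_) (fun t => ?_)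
  · exact diagonal_update_mem_unitaryGroup i (Complex.exp_ofReal_mul_I_mul_star _)
  · exact smul_one_add_smul_mem_unitaryGroup hQ hQQ (Complex.exp_ofReal_mul_I_mul_star _)
  · simp [D]
  · simp only [hR0, mul_one]
    rw [← hom' 1 i, one_mul]
  · simp only [hRpi]
    rw [← hom' Q j, hQdef, ← diagonal_update_mul_swap]
end

section
/- Let n ≥ 2 and let M ∈ Mat_n(ℂ). For every x ∈ ℝⁿ there exists an invertible matrix A ∈ GL_n(ℂ) with tr(M·A) = 0 whose singular values, listed with multiplicity in some order, are exp(x_1),…,exp(x_n). (That is, the matrix amoeba of the hypersurface defined by any linear form A ↦ tr(M·A) on GL_n(ℂ) is all of ℝⁿ.) -/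
open Matrix

/-- Two families indexed by `Fin n` with the same multiset of values differ by a permutation. -/
theorem exists_perm_comp_eq_of_map_univ_eq {n : ℕ} {α : Type*} [LinearOrder α] {f g : Fin n → α}
    (h : Finset.univ.val.map f = Finset.univ.val.map g) :
    ∃ σ : Equiv.Perm (Fin n), f ∘ σ = g := by
  rw [Fin.univ_val_map, Fin.univ_val_map, Multiset.coe_eq_coe] at h
  have hperm : (List.ofFn (f ∘ Tuple.sort f)).Perm (List.ofFn (g ∘ Tuple.sort g)) :=
    ((Tuple.sort f).ofFn_comp_perm f).trans (h.trans ((Tuple.sort g).ofFn_comp_perm g).symm)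
  have heq : f ∘ Tuple.sort f = g ∘ Tuple.sort g :=
    List.ofFn_injective (hperm.eq_of_sortedLE (Tuple.monotone_sort f).sortedLE_ofFn
      (Tuple.monotone_sort g).sortedLE_ofFn)
  refine ⟨(Tuple.sort g).symm.trans (Tuple.sort f), ?_⟩
  ext i
  simpa using congrFun heq ((Tuple.sort g).symm i)

/-- The singular values of `U * diagonal d * V`, for unitary `U`, `V` and nonnegative `d`, are the
entries of `d` up to order. -/
theorem exists_perm_singularValues_unitary_mul_diagonal_mul {n : ℕ}
    {U V : Matrix (Fin n) (Fin n) ℂ} (hU : Uᴴ * U = 1) (hV : V * Vᴴ = 1)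
    {d : Fin n → ℝ} (hd : ∀ i, 0 ≤ d i) :
    ∃ σ : Equiv.Perm (Fin n),
      ∀ i, singularValues (U * diagonal (fun i => (d i : ℂ)) * V) (σ i) = d i := by
  set D : Matrix (Fin n) (Fin n) ℂ := diagonal (fun i => (d i : ℂ)) with hD
  set A := U * D * V
  have hA := isHermitian_mul_conjTranspose_self A
  have hAA : A * Aᴴ = U * (D * Dᴴ * Uᴴ) := by
    simp only [A, conjTranspose_mul, Matrix.mul_assoc]
    rw [← Matrix.mul_assoc V, hV, Matrix.one_mul]
  have hDD : D * Dᴴ = diagonal (fun i => ((d i ^ 2 : ℝ) : ℂ)) := by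
    simp [hD, diagonal_conjTranspose, diagonal_mul_diagonal, pow_two]
  have hchar : (A * Aᴴ).charpoly =
      ∏ i, (Polynomial.X - Polynomial.C ((d i ^ 2 : ℝ) : ℂ)) := by
    rw [hAA, charpoly_mul_comm, Matrix.mul_assoc, hU, Matrix.mul_one, hDD, charpoly_diagonal]
  have hroots := hA.roots_charpoly_eq_eigenvalues
  rw [hchar, Polynomial.roots_prod _ _
    (Finset.prod_ne_zero_iff.mpr fun i _ => Polynomial.X_sub_C_ne_zero _)] at hroots
  have hmap : Finset.univ.val.map hA.eigenvalues = Finset.univ.val.map fun i => d i ^ 2 := by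
    simpa [Multiset.map_map, Function.comp_def, ← Complex.ofReal_pow] using
      congrArg (Multiset.map Complex.re) hroots.symm
  obtain ⟨σ, hσ⟩ := exists_perm_comp_eq_of_map_univ_eq hmap
  refine ⟨σ, fun i => ?_⟩
  have hi : hA.eigenvalues (σ i) = d i ^ 2 := congrFun hσ i
  rw [singularValues, hi, Real.sqrt_sq (hd i)]

/-- A complex square matrix of size at least two can be brought to zero diagonal by multiplying by
unitary matrices on both sides. -/
theorem exists_unitary_mul_mul_unitary_diag_eq_zero {n : ℕ} (hn : 2 ≤ n)
    (M : Matrix (Fin n) (Fin n) ℂ) :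
    ∃ U V : Matrix (Fin n) (Fin n) ℂ, Uᴴ * U = 1 ∧ V * Vᴴ = 1 ∧ ∀ i, (V * M * U) i i = 0 := by
  have hM := isHermitian_conjTranspose_mul_self M
  let q : Fin n → EuclideanSpace ℂ (Fin n) := fun i =>
    Matrix.toEuclideanLin M (hM.eigenvectorBasis i)
  have hq : Pairwise fun i j => inner ℂ (q i) (q j) = 0 := by
    intro i j hij
    have h : inner ℂ (q i) (q j) = inner ℂ (hM.eigenvectorBasis i)
        (Matrix.toEuclideanLin (Mᴴ * M) (hM.eigenvectorBasis j)) := by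
      rw [Matrix.toLpLin_mul_same, LinearMap.comp_apply,
        Matrix.toEuclideanLin_conjTranspose_eq_adjoint, LinearMap.adjoint_inner_right]
    have h' : Matrix.toEuclideanLin (Mᴴ * M) (hM.eigenvectorBasis j) =
        (hM.eigenvalues j : ℂ) • hM.eigenvectorBasis j := by
      ext k
      simpa using congrFun (hM.mulVec_eigenvectorBasis j) k
    rw [h, h', inner_smul_right, hM.eigenvectorBasis.orthonormal.2 hij, mul_zero]
  let b := InnerProductSpace.gramSchmidtOrthonormalBasis (𝕜 := ℂ) (by simp) q
  have hb : ∀ i j, i ≠ j → inner ℂ (b i) (q j) = 0 := by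
    intro i j hij
    by_cases hj : q j = 0
    · rw [hj, inner_zero_right]
    have h := InnerProductSpace.gramSchmidtOrthonormalBasis_apply_of_orthogonal
      (𝕜 := ℂ) (by simp) hq hj
    have h0 : inner ℂ (b i) (b j) = 0 := b.orthonormal.2 hij
    rw [show b j = _ from h, inner_smul_right] at h0
    exact (mul_eq_zero.mp h0).resolve_left (by simpa using hj)
  refine ⟨hM.eigenvectorUnitary, Matrix.of fun i k => star (b (finRotate n i) k), ?_, ?_, ?_⟩
  · exact Unitary.coe_star_mul_self hM.eigenvectorUnitary
  · ext i j
    have h := orthonormal_iff_ite.mp b.orthonormal (finRotate n i) (finRotate n j)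
    simpa [Matrix.mul_apply, PiLp.inner_apply, Matrix.one_apply, mul_comm] using h
  · intro i
    have hne : finRotate n i ≠ i := by
      rw [← Equiv.Perm.mem_support, support_finRotate_of_le hn]
      exact Finset.mem_univ i
    rw [← hb _ _ hne, Matrix.mul_assoc]
    simp [q, Matrix.mul_apply, PiLp.inner_apply, Matrix.mulVec, dotProduct, mul_comm]

/-- For `n ≥ 2` and any `M ∈ Mat_n(ℂ)`, every `x ∈ ℝⁿ` lies in the matrix amoeba of the
linear form `A ↦ tr (M · A)`: there is an invertible `A` with `tr (M · A) = 0` whose singular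
values, listed with multiplicity in some order, are `exp (x 1), …, exp (x n)`. -/
theorem stmt18 {n : ℕ} (hn : 2 ≤ n) (M : Matrix (Fin n) (Fin n) ℂ) (x : Fin n → ℝ) :
    ∃ A : Matrix (Fin n) (Fin n) ℂ, IsUnit A.det ∧ (M * A).trace = 0 ∧
      ∃ σ : Equiv.Perm (Fin n), ∀ i, singularValues A (σ i) = Real.exp (x i) := by
  obtain ⟨U, V, hU, hV, hdiag⟩ := exists_unitary_mul_mul_unitary_diag_eq_zero hn M
  refine ⟨U * diagonal (fun i => (Real.exp (x i) : ℂ)) * V, ?_, ?_,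
    exists_perm_singularValues_unitary_mul_diagonal_mul hU hV fun i => (Real.exp_pos _).le⟩
  · rw [det_mul, det_mul, det_diagonal]
    refine ((isUnit_det_of_left_inverse hU).mul ?_).mul (isUnit_det_of_right_inverse hV)
    simp [Finset.prod_ne_zero_iff]
  · rw [← Matrix.mul_assoc, trace_mul_comm, ← Matrix.mul_assoc, ← Matrix.mul_assoc, trace]
    simp [mul_diagonal, hdiag]
end
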